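/- For every positive integer r and every real ε > 0, there exists an integer N = N(r, ε) such that for all n ≥ N, every regular multigraph of order 2n with multiplicity at most r and degree at least (1+ε)·r·n is 1-factorizable. -/

import Mathlib

/-- A multigraph on vertex type `V`, modeled as a symmetric function giving the
number of parallel edges between each pair of vertices, with no loops. -/
def IsMultigraph {V : Type*} (m : V → V → ℕ) : Prop :=
  (∀ u v, m u v = m v u) ∧ ∀ v, m v v = 0

/-- The degree of a vertex in a multigraph: each parallel edge is counted separately. -/
def mDeg {V : Type*} [Fintype V] (m : V → V → ℕ) (v : V) : ℕ :=
  ∑ w, m v w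

/-- A 1-factor (perfect matching) of the multigraph `m`: a sub-multigraph in which
every vertex has degree exactly one. -/
def IsOneFactor {V : Type*} [Fintype V] (m f : V → V → ℕ) : Prop :=
  (∀ u v, f u v = f v u) ∧ (∀ u v, f u v ≤ m u v) ∧ ∀ v, ∑ w, f v w = 1

/-- A multigraph is 1-factorizable if its edge set (with parallel edges counted
with multiplicity) can be partitioned into 1-factors. -/
def OneFactorizable {V : Type*} [Fintype V] (m : V → V → ℕ) : Prop :=
  ∃ (k : ℕ) (F : Fin k → V → V → ℕ),
    (∀ i, IsOneFactor m (F i)) ∧ ∀ u v, ∑ i, F i u v = m u v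

open Finset

/-- The average of `exp (∑ ± c i)` over all choices of signs is `∏ cosh (c i)`. -/
lemma sum_exp_signed_sum_le {ι : Type*} [Fintype ι] [DecidableEq ι] (c : ι → ℝ) (K : ℝ)
    (hc : ∀ i, |c i| ≤ K) :
    ∑ f : ι → Bool, Real.exp (∑ i, (if f i then c i else -c i)) ≤
      2 ^ Fintype.card ι * Real.exp (Fintype.card ι * (K ^ 2 / 2)) := by
  have h1 : ∑ f : ι → Bool, Real.exp (∑ i, (if f i then c i else -c i)) =
      ∏ i, (2 * Real.cosh (c i)) := by
    simp_rw [Real.exp_sum]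
    rw [← Fintype.prod_sum (fun i (b : Bool) => Real.exp (if b then c i else -c i))]
    refine Finset.prod_congr rfl fun i _ => ?_
    simp [Real.cosh_eq]
    ring
  rw [h1, Finset.prod_mul_distrib, Finset.prod_const, Finset.card_univ]
  refine mul_le_mul_of_nonneg_left ?_ (by positivity)
  calc ∏ i, Real.cosh (c i) ≤ ∏ _i : ι, Real.exp (K ^ 2 / 2) := by
        refine Finset.prod_le_prod (fun i _ => (Real.cosh_pos _).le) fun i _ => ?_
        refine (Real.cosh_le_exp_half_sq _).trans (Real.exp_le_exp.2 ?_)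
        have := sq_le_sq' (by linarith [neg_le_of_abs_le (hc i), hc i]) (le_of_abs_le (hc i))
        linarith
    _ = _ := by
        rw [Finset.prod_const, Finset.card_univ, ← Real.exp_nat_mul]

/-- Any large even set can be halved so that every row of a bounded matrix is almost balanced. -/
lemma exists_balanced_split (r : ℕ) (δ : ℝ) (hδ : 0 < δ) :
    ∃ N : ℕ, ∀ n : ℕ, N ≤ n → ∀ (V : Type) [Fintype V], Fintype.card V = 2 * n →
      ∀ w : V → V → ℕ, (∀ u v, w u v ≤ r) →
        ∃ s : V → Bool, (∀ b, #{v | s v = b} = n) ∧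
          ∀ v, |∑ u, (if s u then (w v u : ℝ) else -(w v u : ℝ))| ≤ δ * n := by
  set R : ℝ := r + 1 with hR
  have hRpos : 0 < R := by positivity
  set c : ℝ := δ ^ 2 / (2 * R ^ 2) with hcdef
  have hcpos : 0 < c := by positivity
  have hlim : ∀ᶠ n : ℕ in Filter.atTop, 4 * (n : ℝ) < Real.exp (c * n) := by
    have h := (Real.tendsto_exp_div_pow_atTop 1).comp
      (tendsto_natCast_atTop_atTop.const_mul_atTop hcpos)
    filter_upwards [h.eventually_gt_atTop (4 / c), Filter.eventually_gt_atTop 0] with n hn hn0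
    have hn0' : (0 : ℝ) < n := by exact_mod_cast hn0
    simp only [Function.comp, pow_one] at hn
    rw [div_lt_div_iff₀ hcpos (by positivity)] at hn
    have : c * (4 * n) < c * Real.exp (c * n) := by linarith
    exact lt_of_mul_lt_mul_left this hcpos.le
  obtain ⟨N, hN⟩ := Filter.eventually_atTop.1 hlim
  refine ⟨N, fun n hn V _ hV w hw => ?_⟩
  classical
  have e : V ≃ Fin n × Bool := Fintype.equivOfCardEq (by simp [hV, mul_comm])
  set side : (Fin n → Bool) → V → Bool := fun f u => xor (f (e u).1) (e u).2 with hside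
  set a : V → Fin n → ℝ := fun v i => (w v (e.symm (i, false)) : ℝ) - w v (e.symm (i, true))
    with ha
  have ha_le : ∀ v i, |a v i| ≤ R := by
    intro v i
    have h1 : (w v (e.symm (i, false)) : ℝ) ≤ r := by exact_mod_cast hw _ _
    have h2 : (w v (e.symm (i, true)) : ℝ) ≤ r := by exact_mod_cast hw _ _
    have h3 : (0 : ℝ) ≤ w v (e.symm (i, false)) := by positivity
    have h4 : (0 : ℝ) ≤ w v (e.symm (i, true)) := by positivity
    rw [abs_le]
    constructor <;> simp only [ha, hR] <;> linarith
  have hsum : ∀ f v, ∑ u, (if side f u then (w v u : ℝ) else -(w v u : ℝ)) =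
      ∑ i, (if f i then a v i else -a v i) := by
    intro f v
    rw [← e.symm.sum_comp, Fintype.sum_prod_type]
    refine Finset.sum_congr rfl fun i _ => ?_
    cases hf : f i <;> simp [hside, ha, hf] <;> ring
  set t : ℝ := δ / R ^ 2 with ht
  have htpos : 0 < t := by positivity
  obtain ⟨f, hf⟩ : ∃ f : Fin n → Bool, ∀ v,
      |∑ i, (if f i then a v i else -a v i)| ≤ δ * n := by
    by_contra! hcon
    have hlow : ∀ f : Fin n → Bool, Real.exp (t * (δ * n)) ≤
        ∑ v, (Real.exp (∑ i, (if f i then t * a v i else -(t * a v i))) +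
          Real.exp (∑ i, (if f i then -t * a v i else -(-t * a v i)))) := by
      intro f
      obtain ⟨v, hv⟩ := hcon f
      refine le_trans ?_ (Finset.single_le_sum (f := fun v =>
        (Real.exp (∑ i, (if f i then t * a v i else -(t * a v i))) +
          Real.exp (∑ i, (if f i then -t * a v i else -(-t * a v i)))))
        (fun _ _ => by positivity) (Finset.mem_univ v))
      have e1 : ∑ i, (if f i then t * a v i else -(t * a v i)) =
          t * ∑ i, (if f i then a v i else -a v i) := by
        rw [Finset.mul_sum]; exact Finset.sum_congr rfl fun i _ => by split_ifs <;> ring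
      have e2 : ∑ i, (if f i then -t * a v i else -(-t * a v i)) =
          t * -∑ i, (if f i then a v i else -a v i) := by
        rw [← Finset.sum_neg_distrib, Finset.mul_sum]
        exact Finset.sum_congr rfl fun i _ => by split_ifs <;> ring
      rw [e1, e2]
      rcases lt_abs.1 hv with h | h
      · have := Real.exp_le_exp.2 (mul_le_mul_of_nonneg_left h.le htpos.le)
        have := Real.exp_pos (t * -∑ i, (if f i then a v i else -a v i))
        linarith
      · have := Real.exp_le_exp.2 (mul_le_mul_of_nonneg_left h.le htpos.le)
        have := Real.exp_pos (t * ∑ i, (if f i then a v i else -a v i))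
        linarith
    have htot := Finset.sum_le_sum fun f (_ : f ∈ (Finset.univ : Finset (Fin n → Bool))) => hlow f
    rw [Finset.sum_comm] at htot
    have hup : ∀ v, ∑ f : Fin n → Bool,
        (Real.exp (∑ i, (if f i then t * a v i else -(t * a v i))) +
          Real.exp (∑ i, (if f i then -t * a v i else -(-t * a v i)))) ≤
        2 * (2 ^ n * Real.exp (n * ((t * R) ^ 2 / 2))) := by
      intro v
      rw [Finset.sum_add_distrib]
      have h1 := sum_exp_signed_sum_le (fun i => t * a v i) (t * R) fun i => by
        rw [abs_mul, abs_of_pos htpos]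
        exact mul_le_mul_of_nonneg_left (ha_le v i) htpos.le
      have h2 := sum_exp_signed_sum_le (fun i => -t * a v i) (t * R) fun i => by
        rw [abs_mul, abs_neg, abs_of_pos htpos]
        exact mul_le_mul_of_nonneg_left (ha_le v i) htpos.le
      rw [Fintype.card_fin] at h1 h2
      linarith
    have htot' := htot.trans (Finset.sum_le_sum fun v _ => hup v)
    simp only [Finset.sum_const, Finset.card_univ, Fintype.card_fun, Fintype.card_bool,
      Fintype.card_fin, nsmul_eq_mul, hV] at htot'
    push_cast at htot'
    have hx : t * (δ * n) = c * n + n * ((t * R) ^ 2 / 2) := by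
      simp only [ht, hcdef]; field_simp; ring
    rw [hx, Real.exp_add] at htot'
    have hpos : 0 < 2 ^ n * Real.exp (n * ((t * R) ^ 2 / 2)) := by positivity
    have := hN n hn
    have : 2 ^ n * Real.exp (n * ((t * R) ^ 2 / 2)) * Real.exp (c * n) ≤
        2 ^ n * Real.exp (n * ((t * R) ^ 2 / 2)) * (4 * n) := by linarith
    have := le_of_mul_le_mul_left this hpos
    linarith
  refine ⟨side f, fun b => ?_, fun v => by rw [hsum]; exact hf v⟩
  rw [← Fintype.card_fin n, ← Finset.card_univ]
  refine Finset.card_bij (fun v _ => (e v).1) (fun _ _ => Finset.mem_univ _) ?_ ?_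
  · intro u hu v hv huv
    simp only [hside, Finset.mem_filter, Finset.mem_univ, true_and] at hu hv
    apply e.injective
    refine Prod.ext huv ?_
    rw [huv] at hu
    have := hu.trans hv.symm
    simpa using this
  · intro i _
    refine ⟨e.symm (i, xor (f i) b), ?_, by simp⟩
    simp [hside]

section Bipartition

variable {V : Type*}

/-- The part of a multigraph inside the two classes of a bipartition. -/
def insidePart (s : V → Bool) (w : V → V → ℕ) (u v : V) : ℕ :=
  if s u = s v then w u v else 0

/-- The part of a multigraph between the two classes of a bipartition. -/
def crossPart (s : V → Bool) (w : V → V → ℕ) (u v : V) : ℕ :=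
  if s u = s v then 0 else w u v

/-- The number of members of `L` that send `v` to the other class of the bipartition. -/
def crossCount (s : V → Bool) (L : Multiset (V → V)) (v : V) : ℕ :=
  L.countP (fun σ => s (σ v) ≠ s v)

@[simp] lemma crossCount_zero (s : V → Bool) (v : V) :
    crossCount s (0 : Multiset (V → V)) v = 0 := rfl

@[simp] lemma crossCount_cons (s : V → Bool) (σ : V → V) (L : Multiset (V → V)) (v : V) :
    crossCount s (σ ::ₘ L) v = crossCount s L v + if s (σ v) ≠ s v then 1 else 0 :=
  Multiset.countP_cons ..

lemma crossCount_le_card (s : V → Bool) (L : Multiset (V → V)) (v : V) :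
    crossCount s L v ≤ L.card := Multiset.countP_le_card _ _

lemma insidePart_add_crossPart (s : V → Bool) (w : V → V → ℕ) (u v : V) :
    insidePart s w u v + crossPart s w u v = w u v := by
  unfold insidePart crossPart; split_ifs <;> simp

end Bipartition

/-- The number of members of the family `L` of maps that send `u` to `v`. A family of involutions
is viewed as a family of matchings, in which fixed points are unmatched vertices. -/
def useCount {V : Type*} [DecidableEq V] (L : Multiset (V → V)) (u v : V) : ℕ :=
  L.countP (fun σ => σ u = v)

section UseCount

variable {V : Type*} [DecidableEq V]

@[simp] lemma useCount_zero (u v : V) : useCount (0 : Multiset (V → V)) u v = 0 := rfl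

@[simp] lemma useCount_cons (σ : V → V) (L : Multiset (V → V)) (u v : V) :
    useCount (σ ::ₘ L) u v = useCount L u v + if σ u = v then 1 else 0 :=
  Multiset.countP_cons ..

@[simp] lemma useCount_add (L M : Multiset (V → V)) (u v : V) :
    useCount (L + M) u v = useCount L u v + useCount M u v :=
  Multiset.countP_add ..

lemma useCount_mono {L M : Multiset (V → V)} (h : L ≤ M) (u v : V) :
    useCount L u v ≤ useCount M u v :=
  Multiset.countP_le_of_le _ h

lemma sum_useCount [Fintype V] (L : Multiset (V → V)) (u : V) :
    ∑ v, useCount L u v = L.card := by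
  induction L using Multiset.induction_on with
  | empty => simp
  | cons σ L ih => simp [Finset.sum_add_distrib, ih]

lemma useCount_comm {L : Multiset (V → V)} (hL : ∀ σ ∈ L, Function.Involutive σ) (u v : V) :
    useCount L u v = useCount L v u :=
  Multiset.countP_congr rfl fun σ hσ => by
    have := hL σ hσ
    simp only [eq_iff_iff]
    constructor
    · rintro rfl; exact this u
    · rintro rfl; exact this v

lemma useCount_self_eq_zero {L : Multiset (V → V)} (hL : ∀ σ ∈ L, ∀ v, σ v ≠ v) (v : V) :
    useCount L v v = 0 :=
  Multiset.countP_eq_zero.2 fun σ hσ => hL σ hσ v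

lemma sum_crossPart_useCount [Fintype V] (s : V → Bool) (L : Multiset (V → V)) (v : V) :
    ∑ u, crossPart s (useCount L) v u = crossCount s L v := by
  induction L using Multiset.induction_on with
  | empty => simp [crossPart]
  | cons σ L ih =>
    rw [crossCount_cons, ← ih]
    have : ∀ u, crossPart s (useCount (σ ::ₘ L)) v u = crossPart s (useCount L) v u +
        if σ v = u then (if s (σ v) ≠ s v then 1 else 0) else 0 := by
      intro u
      simp only [crossPart, useCount_cons]
      grind
    simp [this, Finset.sum_add_distrib]

lemma sum_insidePart_useCount [Fintype V] (s : V → Bool) (L : Multiset (V → V)) (v : V) :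
    ∑ u, insidePart s (useCount L) v u + crossCount s L v = L.card := by
  rw [← sum_crossPart_useCount, ← Finset.sum_add_distrib]
  simp_rw [insidePart_add_crossPart]
  exact sum_useCount L v

end UseCount

/-- A square matrix of naturals with constant line sums is a sum of permutation matrices. -/
lemma exists_perms_of_line_sums {α : Type*} [Fintype α] [DecidableEq α] (D : ℕ) (M : α → α → ℕ)
    (hrow : ∀ a, ∑ b, M a b = D) (hcol : ∀ b, ∑ a, M a b = D) :
    ∃ P : Multiset (Equiv.Perm α), P.card = D ∧ ∀ a b, P.countP (fun π => π a = b) = M a b := by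
  induction D generalizing M with
  | zero =>
    refine ⟨0, rfl, fun a b => ?_⟩
    have := hrow a
    simp only [Finset.sum_eq_zero_iff, Finset.mem_univ, true_imp_iff] at this
    simp [this b]
  | succ D ih =>
    obtain ⟨f, hf, hfM⟩ := (Finset.all_card_le_biUnion_card_iff_exists_injective
      (fun a => Finset.univ.filter fun b => 0 < M a b)).1 (fun X => by
        set Y := X.biUnion fun a => Finset.univ.filter fun b => 0 < M a b with hY
        have h1 : ∑ a ∈ X, ∑ b ∈ Y, M a b = X.card * (D + 1) := by
          rw [← smul_eq_mul, ← Finset.sum_const]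
          refine Finset.sum_congr rfl fun a ha => ?_
          rw [← hrow a]
          refine Finset.sum_subset (Finset.subset_univ _) fun b _ hb => ?_
          by_contra hne
          exact hb (Finset.mem_biUnion.2 ⟨a, ha, by simp [Nat.pos_of_ne_zero hne]⟩)
        have h2 : ∑ a ∈ X, ∑ b ∈ Y, M a b ≤ Y.card * (D + 1) := by
          rw [Finset.sum_comm, ← smul_eq_mul, ← Finset.sum_const]
          refine Finset.sum_le_sum fun b _ => ?_
          rw [← hcol b]
          exact Finset.sum_le_sum_of_subset (Finset.subset_univ _)
        exact Nat.le_of_mul_le_mul_right (h1 ▸ h2) (Nat.succ_pos D))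
    set π : Equiv.Perm α := Equiv.ofBijective f (Finite.injective_iff_bijective.1 hf) with hπ
    have hπM : ∀ a b, (if π a = b then 1 else 0) ≤ M a b := by
      intro a b
      split_ifs with h
      · have := hfM a
        simp only [Finset.mem_filter, Finset.mem_univ, true_and] at this
        subst h
        exact this
      · exact Nat.zero_le _
    have hsub : ∀ a b, M a b - (if π a = b then 1 else 0) + (if π a = b then 1 else 0) = M a b :=
      fun a b => Nat.sub_add_cancel (hπM a b)
    obtain ⟨P, hPc, hP⟩ := ih (fun a b => M a b - if π a = b then 1 else 0)
      (fun a => by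
        have := hrow a
        rw [← Finset.sum_congr rfl fun b _ => hsub a b, Finset.sum_add_distrib] at this
        simpa using this)
      (fun b => by
        have := hcol b
        rw [← Finset.sum_congr rfl fun a _ => hsub a b, Finset.sum_add_distrib] at this
        have h1 : ∑ a, (if π a = b then 1 else 0) = 1 := by
          simp [← Equiv.eq_symm_apply]
        rw [h1] at this
        exact Nat.succ_injective this)
    refine ⟨π ::ₘ P, by simp [hPc], fun a b => ?_⟩
    rw [Multiset.countP_cons, hP]
    exact hsub a b

/-- The map that follows `π` on one class of a bipartition and `π⁻¹` on the other. -/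
def foldPerm {V : Type*} (s : V → Bool) (π : Equiv.Perm V) (u : V) : V :=
  if s u then π u else π.symm u

lemma foldPerm_involutive {V : Type*} {s : V → Bool} {π : Equiv.Perm V}
    (h : ∀ u, s (π u) = s u → π u = u) : Function.Involutive (foldPerm s π) := by
  intro u
  by_cases hu : s u = true
  · by_cases hv : s (π u) = true
    · have e : foldPerm s π u = u := by simp [foldPerm, hu, h u (hv.trans hu.symm)]
      rw [e, e]
    · simp [foldPerm, hu, hv]
  · by_cases hv : s (π.symm u) = true
    · simp [foldPerm, hu, hv]
    · have h1 : u = π.symm u := by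
        have := h (π.symm u) (by simp [hu, hv])
        rwa [Equiv.apply_symm_apply] at this
      have e : foldPerm s π u = u := by simp [foldPerm, hu, ← h1]
      rw [e, e]

/-- The theorem of König: a bipartite multigraph with degrees at most `D` is a union of `D`
matchings. -/
lemma exists_matchings_of_bipartite {V : Type*} [Fintype V] [DecidableEq V] (s : V → Bool)
    (w : V → V → ℕ) (hsymm : ∀ u v, w u v = w v u) (hs : ∀ u v, s u = s v → w u v = 0) (D : ℕ)
    (hD : ∀ u, ∑ v, w u v ≤ D) :
    ∃ L : Multiset (V → V), L.card = D ∧ (∀ σ ∈ L, Function.Involutive σ) ∧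
      ∀ u v, u ≠ v → useCount L u v = w u v := by
  set M : V → V → ℕ := fun u v => w u v + if u = v then D - ∑ x, w u x else 0 with hM
  have hrow : ∀ u, ∑ v, M u v = D := by
    intro u
    simp only [hM, Finset.sum_add_distrib, Finset.sum_ite_eq, Finset.mem_univ, if_true]
    have := hD u
    omega
  have hMsymm : ∀ u v, M u v = M v u := by
    intro u v
    by_cases h : u = v
    · rw [h]
    · simp [hM, h, Ne.symm h, hsymm u v]
  obtain ⟨P, hPc, hP⟩ := exists_perms_of_line_sums D M hrow
    (fun b => by rw [← hrow b]; exact Finset.sum_congr rfl fun a _ => hMsymm a b)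
  refine ⟨P.map (foldPerm s), by simpa using hPc, ?_, ?_⟩
  · intro σ hσ
    obtain ⟨π, hπ, rfl⟩ := Multiset.mem_map.1 hσ
    refine foldPerm_involutive fun u hu => ?_
    by_contra hne
    have h0 : M u (π u) = 0 := by simp [hM, Ne.symm hne, hs u (π u) hu.symm]
    rw [← hP] at h0
    exact Multiset.countP_eq_zero.1 h0 π hπ rfl
  · intro u v huv
    rw [useCount, Multiset.countP_map, ← Multiset.countP_eq_card_filter]
    by_cases hu : s u = true
    · simp only [foldPerm, hu, if_true]
      rw [hP]
      simp [hM, huv]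
    · simp only [foldPerm, hu]
      have : P.countP (fun π => π.symm u = v) = P.countP (fun π => π v = u) :=
        Multiset.countP_congr rfl fun π _ => by
          rw [eq_iff_iff, Equiv.symm_apply_eq, eq_comm]
      simp only [Bool.false_eq_true, if_false]
      rw [this, hP, hMsymm]
      simp [hM, huv]

lemma sum_insidePart_add_sum_crossPart {V : Type*} [Fintype V] (s : V → Bool) (w : V → V → ℕ)
    (v : V) : ∑ u, insidePart s w v u + ∑ u, crossPart s w v u = ∑ u, w v u := by
  rw [← Finset.sum_add_distrib]
  exact Finset.sum_congr rfl fun u _ => insidePart_add_crossPart s w v u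

lemma insidePart_symm {V : Type*} (s : V → Bool) {w : V → V → ℕ} (hw : ∀ u v, w u v = w v u)
    (u v : V) : insidePart s w u v = insidePart s w v u := by
  simp only [insidePart, hw u v, eq_comm]

lemma crossPart_symm {V : Type*} (s : V → Bool) {w : V → V → ℕ} (hw : ∀ u v, w u v = w v u)
    (u v : V) : crossPart s w u v = crossPart s w v u := by
  simp only [crossPart, hw u v, eq_comm]

lemma insidePart_le {V : Type*} (s : V → Bool) (w : V → V → ℕ) (u v : V) :
    insidePart s w u v ≤ w u v := by
  unfold insidePart; split_ifs <;> simp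

lemma crossPart_le {V : Type*} (s : V → Bool) (w : V → V → ℕ) (u v : V) :
    crossPart s w u v ≤ w u v := by
  unfold crossPart; split_ifs <;> simp

lemma abs_sum_insidePart_sub_sum_crossPart {V : Type*} [Fintype V] (s : V → Bool)
    (w : V → V → ℕ) (v : V) :
    |(∑ u, insidePart s w v u : ℝ) - ∑ u, (crossPart s w v u : ℝ)| =
      |∑ u, (if s u then (w v u : ℝ) else -(w v u : ℝ))| := by
  rw [← Finset.sum_sub_distrib]
  cases h : s v
  · rw [← abs_neg, ← Finset.sum_neg_distrib]
    congr 1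
    refine Finset.sum_congr rfl fun u _ => ?_
    cases h' : s u <;> simp [insidePart, crossPart, h, h']
  · congr 1
    refine Finset.sum_congr rfl fun u _ => ?_
    cases h' : s u <;> simp [insidePart, crossPart, h, h']

/-- All but a small part of a large multigraph of bounded multiplicity and maximum degree at most
`D` can be edge-coloured with few more than `D` colours. -/
lemma exists_near_edge_coloring (r j : ℕ) (η : ℝ) (hη : 0 < η) :
    ∃ N : ℕ, ∀ n : ℕ, N ≤ n → ∀ (V : Type) [Fintype V] [DecidableEq V],
      Fintype.card V = 2 * n → ∀ w : V → V → ℕ, (∀ u v, w u v = w v u) →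
        (∀ u v, w u v ≤ r) → ∀ D : ℕ, (∀ u, ∑ v, w u v ≤ D) →
          ∃ L : Multiset (V → V), (∀ σ ∈ L, Function.Involutive σ) ∧
            (∀ u v, u ≠ v → useCount L u v ≤ w u v) ∧ (L.card : ℝ) ≤ D + η * n ∧
            ∀ u, (∑ v, w u v : ℝ) + useCount L u u ≤ L.card + D / 2 ^ j + η * n := by
  induction j generalizing η with
  | zero =>
    refine ⟨0, fun n _ V _ _ _ w _ _ D hD => ⟨0, by simp, by simp, ?_, fun u => ?_⟩⟩
    · simp; positivity
    · have h1 : (∑ v, w u v : ℝ) ≤ D := by exact_mod_cast hD u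
      have h2 : 0 ≤ η * n := by positivity
      simp
      linarith
  | succ j ih =>
    obtain ⟨N₁, hN₁⟩ := ih (η / 2) (by positivity)
    obtain ⟨N₂, hN₂⟩ := exists_balanced_split r (η / 2) (by positivity)
    refine ⟨max N₁ N₂, fun n hn V _ _ hV w hsymm hr D hD => ?_⟩
    obtain ⟨s, -, hs⟩ := hN₂ n (le_of_max_le_right hn) V hV w hr
    set D' : ℕ := ⌊((D : ℝ) + η / 2 * n) / 2⌋₊ with hD'
    have hD'le : (D' : ℝ) ≤ (D + η / 2 * n) / 2 := Nat.floor_le (by positivity)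
    have hparts : ∀ v, ∑ u, insidePart s w v u ≤ D' ∧ ∑ u, crossPart s w v u ≤ D' := by
      intro v
      have h1 := hs v
      rw [← abs_sum_insidePart_sub_sum_crossPart, abs_le] at h1
      have h2 : (∑ u, insidePart s w v u : ℝ) + ∑ u, (crossPart s w v u : ℝ) = ∑ u, (w v u : ℝ) := by
        exact_mod_cast sum_insidePart_add_sum_crossPart s w v
      have h3 : (∑ u, w v u : ℝ) ≤ D := by exact_mod_cast hD v
      constructor <;> refine Nat.le_floor ?_ <;> push_cast <;> linarith
    obtain ⟨L₁, hL₁c, hL₁i, hL₁⟩ := exists_matchings_of_bipartite s (crossPart s w)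
      (crossPart_symm s hsymm) (fun u v h => by simp [crossPart, h]) D' (fun v => (hparts v).2)
    obtain ⟨L₂, hL₂i, hL₂, hL₂c, hL₂d⟩ := hN₁ n (le_of_max_le_left hn) V hV (insidePart s w)
      (insidePart_symm s hsymm) (fun u v => (insidePart_le s w u v).trans (hr u v)) D'
      (fun v => (hparts v).1)
    refine ⟨L₁ + L₂, ?_, ?_, ?_, ?_⟩
    · intro σ hσ
      rcases Multiset.mem_add.1 hσ with h | h
      exacts [hL₁i σ h, hL₂i σ h]
    · intro u v huv
      rw [useCount_add, hL₁ u v huv, ← insidePart_add_crossPart s w u v, add_comm]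
      exact Nat.add_le_add_right (hL₂ u v huv) _
    · rw [Multiset.card_add, hL₁c]
      push_cast
      linarith
    · intro u
      have h1 : ∑ v, crossPart s w u v + useCount L₁ u u = D' := by
        rw [← hL₁c, ← sum_useCount L₁ u, ← Finset.sum_erase_add _ _ (Finset.mem_univ u),
          ← Finset.sum_erase_add (a := u) (f := fun v => useCount L₁ u v) _ (Finset.mem_univ u)]
        rw [Finset.sum_congr rfl fun v hv => hL₁ u v (Finset.ne_of_mem_erase hv).symm]
        have h0 : crossPart s w u u = 0 := by simp [crossPart]
        rw [h0, add_zero]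
      have h2 := hL₂d u
      have h3 : (∑ v, insidePart s w u v : ℝ) + ∑ v, (crossPart s w u v : ℝ) =
          ∑ v, (w u v : ℝ) := by
        exact_mod_cast sum_insidePart_add_sum_crossPart s w u
      have h4 : (∑ v, crossPart s w u v : ℝ) + useCount L₁ u u = D' := by exact_mod_cast h1
      rw [Multiset.card_add, hL₁c, useCount_add]
      push_cast
      have h5 : (D' : ℝ) / 2 ^ j ≤ D / 2 ^ (j + 1) + η / 2 * n / 2 := by
        calc (D' : ℝ) / 2 ^ j ≤ ((D + η / 2 * n) / 2) / 2 ^ j := by gcongr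
          _ = D / 2 ^ (j + 1) + (η / 2 * n / 2) / 2 ^ j := by rw [pow_succ]; field_simp
          _ ≤ _ := by
            have : η / 2 * n / 2 / 2 ^ j ≤ η / 2 * n / 2 :=
              div_le_self (by positivity) (one_le_pow₀ one_le_two)
            linarith
      have h6 : 0 ≤ η * n := by positivity
      linarith

/-- An involution of a finite type of even cardinality with one fixed point has another. -/
lemma exists_ne_fixed_of_even {V : Type*} [Fintype V] [DecidableEq V]
    (hV : Even (Fintype.card V)) {σ : V → V} (hσ : Function.Involutive σ) {x : V} (hx : σ x = x) :
    ∃ y, y ≠ x ∧ σ y = y := by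
  have h := Equiv.Perm.card_fixedPoints_modEq (α := V) (f := σ) (p := 2) (n := 1)
    (funext fun v => hσ v)
  by_contra! hcon
  have h1 : Fintype.card (Function.fixedPoints σ) = 1 := by
    rw [Fintype.card_eq_one_iff]
    refine ⟨⟨x, hx⟩, fun y => Subtype.ext ?_⟩
    by_contra hne
    exact hcon y.1 hne y.2
  rw [h1] at h
  rw [Nat.ModEq] at h
  rw [Nat.even_iff] at hV
  omega

/-- Rewiring an involution along a path of length three joining two fixed points. -/
lemma exists_rewire_four {V : Type*} [DecidableEq V] {σ : V → V} (hσ : Function.Involutive σ)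
    {x y p : V} (hx : σ x = x) (hy : σ y = y) (hyx : y ≠ x) (hp : σ p ≠ p)
    {Adj : V → V → Prop} (hsymm : ∀ u v, Adj u v → Adj v u) (hxp : Adj x p)
    (hpy : Adj (σ p) y) :
    ∃ σ' : V → V, Function.Involutive σ' ∧ (∀ v ∉ ({x, p, y, σ p} : Finset V), σ' v = σ v) ∧
      ∀ v ∈ ({x, p, y, σ p} : Finset V), Adj v (σ' v) := by
  have hpp := hσ p
  have h1 : x ≠ p := by rintro rfl; exact hp hx
  have h2 : y ≠ p := by rintro rfl; exact hp hy
  have h3 : x ≠ σ p := by rintro rfl; exact hp (hx.symm.trans hpp)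
  have h4 : y ≠ σ p := by rintro rfl; exact hp (hy.symm.trans hpp)
  refine ⟨fun v => if v = x then p else if v = p then x else if v = y then σ p else
      if v = σ p then y else σ v, ?_, ?_, ?_⟩
  · clear hsymm hxp hpy
    intro v
    have := hσ v
    by_cases a1 : v = x
    · subst a1; simp [h1.symm]
    by_cases a2 : v = p
    · subst a2; simp [h1.symm]
    by_cases a3 : v = y
    · subst a3; simp [hyx, h2, hp, h3.symm, h4.symm]
    by_cases a4 : v = σ p
    · subst a4; simp [hyx, h2, hp, h3.symm, h4.symm]
    have b1 : σ v ≠ x := by intro h; rw [h, hx] at this; exact a1 this.symm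
    have b2 : σ v ≠ p := by intro h; rw [h] at this; exact a4 this.symm
    have b3 : σ v ≠ y := by intro h; rw [h, hy] at this; exact a3 this.symm
    have b4 : σ v ≠ σ p := fun h => a2 (hσ.injective h)
    simp [a1, a2, a3, a4, b1, b2, b3, b4, this]
  · intro v hv
    simp only [Finset.mem_insert, Finset.mem_singleton, not_or] at hv
    simp [hv]
  · intro v hv
    simp only [Finset.mem_insert, Finset.mem_singleton] at hv
    rcases hv with rfl | rfl | rfl | rfl
    · simpa using hxp
    · simpa [h1.symm] using hsymm _ _ hxp
    · simpa [hyx, h2] using hsymm _ _ hpy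
    · simpa [hp, h3.symm, h4.symm] using hpy

/-- Rewiring an involution along an alternating path of length five joining two fixed points. -/
lemma exists_rewire_six {V : Type*} [DecidableEq V] {σ : V → V} (hσ : Function.Involutive σ)
    {x y p c : V} (hx : σ x = x) (hy : σ y = y) (hyx : y ≠ x) (hp : σ p ≠ p) (hc : σ c ≠ c)
    (hpc : p ≠ c) (hpc' : p ≠ σ c)
    {Adj : V → V → Prop} (hsymm : ∀ u v, Adj u v → Adj v u) (hxp : Adj x p)
    (hpcA : Adj (σ p) (σ c)) (hyc : Adj y c) :
    ∃ σ' : V → V, Function.Involutive σ' ∧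
      (∀ v ∉ ({x, p, y, c, σ p, σ c} : Finset V), σ' v = σ v) ∧
      ∀ v ∈ ({x, p, y, c, σ p, σ c} : Finset V), Adj v (σ' v) := by
  have hpp := hσ p
  have hcc := hσ c
  have h1 : p ≠ x := by rintro rfl; exact hp hx
  have h2 : p ≠ y := by rintro rfl; exact hp hy
  have h3 : σ p ≠ x := by intro h; rw [h, hx] at hpp; exact hp (h.trans hpp)
  have h4 : σ p ≠ y := by intro h; rw [h, hy] at hpp; exact hp (h.trans hpp)
  have k1 : c ≠ x := by rintro rfl; exact hc hx
  have k2 : c ≠ y := by rintro rfl; exact hc hy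
  have k3 : σ c ≠ x := by intro h; rw [h, hx] at hcc; exact hc (h.trans hcc)
  have k4 : σ c ≠ y := by intro h; rw [h, hy] at hcc; exact hc (h.trans hcc)
  have l1 : σ p ≠ c := by intro h; rw [h] at hpp; exact hpc' hpp.symm
  have l2 : σ c ≠ σ p := fun h => hpc (hσ.injective h).symm
  refine ⟨fun v => if v = x then p else if v = p then x else if v = y then c else
      if v = c then y else if v = σ p then σ c else if v = σ c then σ p else σ v, ?_, ?_, ?_⟩
  · clear hsymm hxp hpcA hyc
    intro v
    have := hσ v
    by_cases a1 : v = x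
    · subst a1; simp [h1]
    by_cases a2 : v = p
    · subst a2; simp [h1]
    by_cases a3 : v = y
    · subst a3; simp [hyx, h2.symm, hpc.symm, k1, k2]
    by_cases a4 : v = c
    · subst a4; simp [hyx, h2.symm, hpc.symm, k1, k2]
    by_cases a5 : v = σ p
    · subst a5; simp [h3, hp, h4, l1, k3, hpc'.symm, k4, hc, l2]
    by_cases a6 : v = σ c
    · subst a6; simp [h3, hp, h4, l1, k3, hpc'.symm, k4, hc, l2]
    have b1 : σ v ≠ x := by intro h; rw [h, hx] at this; exact a1 this.symm
    have b2 : σ v ≠ p := by intro h; rw [h] at this; exact a5 this.symm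
    have b3 : σ v ≠ y := by intro h; rw [h, hy] at this; exact a3 this.symm
    have b4 : σ v ≠ c := by intro h; rw [h] at this; exact a6 this.symm
    have b5 : σ v ≠ σ p := fun h => a2 (hσ.injective h)
    have b6 : σ v ≠ σ c := fun h => a4 (hσ.injective h)
    simp [a1, a2, a3, a4, a5, a6, b1, b2, b3, b4, b5, b6, this]
  · intro v hv
    simp only [Finset.mem_insert, Finset.mem_singleton, not_or] at hv
    simp [hv]
  · intro v hv
    simp only [Finset.mem_insert, Finset.mem_singleton] at hv
    rcases hv with rfl | rfl | rfl | rfl | rfl | rfl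
    · simpa using hxp
    · simpa [h1] using hsymm _ _ hxp
    · simpa [hyx, h2.symm] using hyc
    · simpa [k1, k2, hpc.symm] using hsymm _ _ hyc
    · simpa [h3, hp, h4, l1] using hpcA
    · simpa [k3, hpc'.symm, k4, hc, l2] using hsymm _ _ hpcA

/-- A matching inside the classes of a balanced bipartition that misses few vertices becomes
perfect after few changes, using only edges of a dense bipartite graph between the classes and
leaving the matched vertices of a given small set `Z` untouched. -/
lemma exists_perfect_of_few_fixed {V : Type*} [Fintype V] [DecidableEq V] {s : V → Bool} {n : ℕ}
    (hs : ∀ b, #{v | s v = b} = n) (hV : Even (Fintype.card V)) (Adj : V → V → Prop)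
    [DecidableRel Adj] (hsymm : ∀ u v, Adj u v → Adj v u) (hcross : ∀ u v, Adj u v → s u ≠ s v)
    {q : ℕ} (hq : ∀ u, q ≤ #{v | Adj u v}) (Z : Finset V) {b : ℕ}
    (hb : n + 2 * (2 * #Z + b) < 2 * q) {σ₀ : V → V} (hσ₀ : Function.Involutive σ₀)
    (hside : ∀ v, s (σ₀ v) = s v) (hfix : 3 * #{v | σ₀ v = v} ≤ b) :
    ∃ τ : V → V, Function.Involutive τ ∧ (∀ v, τ v ≠ v) ∧ (∀ v, τ v = σ₀ v ∨ Adj v (τ v)) ∧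
      (∀ v ∈ Z, σ₀ v ≠ v → τ v = σ₀ v) ∧ #{v | τ v ≠ σ₀ v} ≤ b := by
  suffices key : ∀ (k : ℕ) (σ : V → V), Function.Involutive σ →
      (∀ v, σ v = σ₀ v ∨ Adj v (σ v)) → (∀ v ∈ Z, σ₀ v ≠ v → σ v = σ₀ v) →
      #{v | σ v ≠ σ₀ v} + 3 * #{v | σ v = v} ≤ b → #{v | σ v = v} = k →
      ∃ τ : V → V, Function.Involutive τ ∧ (∀ v, τ v ≠ v) ∧ (∀ v, τ v = σ₀ v ∨ Adj v (τ v)) ∧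
        (∀ v ∈ Z, σ₀ v ≠ v → τ v = σ₀ v) ∧ #{v | τ v ≠ σ₀ v} ≤ b from
    key _ σ₀ hσ₀ (fun _ => Or.inl rfl) (fun _ _ _ => rfl) (by simpa using hfix) rfl
  intro k
  induction k using Nat.strong_induction_on with
  | _ k ih =>
  intro σ hσ hAdj hZ hbud hk
  have hirr : ∀ v, ¬ Adj v v := fun v h => hcross v v h rfl
  by_cases hfree : ∀ v, σ v ≠ v
  · exact ⟨σ, hσ, hfree, hAdj, hZ, by omega⟩
  push Not at hfree
  obtain ⟨x, hx⟩ := hfree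
  obtain ⟨y, hyx, hy⟩ := exists_ne_fixed_of_even hV hσ hx
  set G : Finset V := {v | σ v = σ₀ v ∧ σ v ≠ v ∧ v ∉ Z ∧ σ₀ v ∉ Z} with hG
  have hGc : #Gᶜ ≤ 2 * #Z + b := by
    have hsub : Gᶜ ⊆ (({v | σ v ≠ σ₀ v} : Finset V) ∪ ({v | σ v = v} : Finset V)) ∪
        (Z ∪ Z.image σ₀) := by
      intro v hv
      by_contra hnot
      simp only [Finset.mem_union, Finset.mem_filter, Finset.mem_univ, true_and,
        Finset.mem_image, not_or] at hnot
      refine Finset.mem_compl.1 hv ?_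
      simp only [hG, Finset.mem_filter, Finset.mem_univ, true_and]
      exact ⟨not_not.1 hnot.1.1, hnot.1.2, hnot.2.1, fun h => hnot.2.2 ⟨_, h, hσ₀ v⟩⟩
    have h1 := Finset.card_le_card hsub
    have h2 := Finset.card_union_le
      (({v | σ v ≠ σ₀ v} : Finset V) ∪ ({v | σ v = v} : Finset V)) (Z ∪ Z.image σ₀)
    have h3 := Finset.card_union_le ({v | σ v ≠ σ₀ v} : Finset V) {v | σ v = v}
    have h4 := Finset.card_union_le Z (Z.image σ₀)
    have h5 := Finset.card_image_le (s := Z) (f := σ₀)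
    omega
  have hgood : ∀ u, q ≤ #{v ∈ G | Adj u v} + (2 * #Z + b) := by
    intro u
    have hsub : ({v | Adj u v} : Finset V) ⊆ {v ∈ G | Adj u v} ∪ Gᶜ := by
      intro v hv
      simp only [Finset.mem_filter, Finset.mem_univ, true_and] at hv
      simp only [Finset.mem_union, Finset.mem_filter, Finset.mem_compl, hv, and_true]
      tauto
    have := Finset.card_le_card hsub
    have := Finset.card_union_le {v ∈ G | Adj u v} Gᶜ
    have := hq u
    omega
  have hGmem : ∀ v ∈ G, σ v = σ₀ v ∧ σ v ≠ v ∧ v ∉ Z ∧ σ v ∉ Z ∧ s (σ v) = s v := by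
    intro v hv
    simp only [hG, Finset.mem_filter, Finset.mem_univ, true_and] at hv
    obtain ⟨h1, h2, h3, h4⟩ := hv
    exact ⟨h1, h2, h3, h1 ▸ h4, h1 ▸ hside v⟩
  have hlink : ∀ u v, s u = s v → ∃ p ∈ G, Adj u p ∧ Adj (σ p) v := by
    intro u v huv
    have hne :
        ((({p ∈ G | Adj u p} : Finset V).image σ) ∩ ({p | Adj v p} : Finset V)).Nonempty := by
      refine Finset.inter_nonempty_of_card_lt_card_add_card
        (s := ({p | s p = !s u} : Finset V)) ?_ ?_ ?_
      · intro p hp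
        obtain ⟨p', hp', rfl⟩ := Finset.mem_image.1 hp
        rw [Finset.mem_filter] at hp'
        have h1 := (hGmem p' hp'.1).2.2.2.2
        have h2 := hcross _ _ hp'.2
        simp only [Finset.mem_filter, Finset.mem_univ, true_and, h1]
        exact Bool.eq_not_of_ne h2.symm
      · intro p hp
        simp only [Finset.mem_filter, Finset.mem_univ, true_and] at hp ⊢
        rw [huv]
        exact Bool.eq_not_of_ne (hcross _ _ hp).symm
      · rw [hs, Finset.card_image_of_injective _ hσ.injective]
        have := hgood u
        have := hq v
        omega
    obtain ⟨p, hp⟩ := hne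
    rw [Finset.mem_inter, Finset.mem_image] at hp
    obtain ⟨⟨p', hp', rfl⟩, hp⟩ := hp
    rw [Finset.mem_filter] at hp' hp
    exact ⟨p', hp'.1, hp'.2, hsymm _ _ hp.2⟩
  have hfinish : ∀ (σ' : V → V) (S : Finset V), #S ≤ 6 → Function.Involutive σ' →
      (∀ v ∉ S, σ' v = σ v) → (∀ v ∈ S, Adj v (σ' v)) →
      (∀ v ∈ S, v = x ∨ v = y ∨ (v ∉ Z ∧ σ v ≠ v)) → x ∈ S → y ∈ S →
      ∃ τ : V → V, Function.Involutive τ ∧ (∀ v, τ v ≠ v) ∧ (∀ v, τ v = σ₀ v ∨ Adj v (τ v)) ∧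
        (∀ v ∈ Z, σ₀ v ≠ v → τ v = σ₀ v) ∧ #{v | τ v ≠ σ₀ v} ≤ b := by
    intro σ' S hS hσ' hoff hon hSZ hxS hyS
    have hfix0 : ∀ v, σ v = v → σ₀ v = v := by
      intro v hv
      rcases hAdj v with h | h
      · rw [← h, hv]
      · rw [hv] at h
        exact absurd h (hirr v)
    have hfixS : ∀ v, σ' v = v → v ∉ S ∧ σ v = v := by
      intro v hv
      have hvS : v ∉ S := fun h => hirr v (by simpa [hv] using hon v h)
      exact ⟨hvS, by rw [← hoff v hvS, hv]⟩
    have hfixcard : #{v | σ' v = v} + 2 ≤ #{v | σ v = v} := by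
      have hxn : x ∉ insert y ({v | σ' v = v} : Finset V) := by
        simp only [Finset.mem_insert, Finset.mem_filter, Finset.mem_univ, true_and, not_or]
        exact ⟨hyx.symm, fun h => (hfixS x h).1 hxS⟩
      have hyn : y ∉ ({v | σ' v = v} : Finset V) := by
        simp only [Finset.mem_filter, Finset.mem_univ, true_and]
        exact fun h => (hfixS y h).1 hyS
      rw [← Nat.add_assoc _ 1 1, ← Finset.card_insert_of_notMem hyn,
        ← Finset.card_insert_of_notMem hxn]
      refine Finset.card_le_card fun v hv => ?_
      simp only [Finset.mem_insert, Finset.mem_filter, Finset.mem_univ, true_and] at hv ⊢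
      rcases hv with rfl | rfl | hv
      exacts [hx, hy, (hfixS v hv).2]
    have hchg : #{v | σ' v ≠ σ₀ v} ≤ #{v | σ v ≠ σ₀ v} + 6 := by
      refine (Finset.card_le_card fun v hv => ?_).trans
        ((Finset.card_union_le ({v | σ v ≠ σ₀ v} : Finset V) S).trans
          (Nat.add_le_add_left hS _))
      simp only [Finset.mem_union, Finset.mem_filter, Finset.mem_univ, true_and] at hv ⊢
      by_contra! hcon
      exact hv (by rw [hoff v hcon.2, hcon.1])
    refine ih #{v | σ' v = v} (by omega) σ' hσ' (fun v => ?_) (fun v hvZ hv => ?_) (by omega) rfl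
    · by_cases h : v ∈ S
      · exact Or.inr (hon v h)
      · rw [hoff v h]; exact hAdj v
    · by_cases h : v ∈ S
      · rcases hSZ v h with rfl | rfl | h'
        exacts [absurd (hfix0 _ hx) hv, absurd (hfix0 _ hy) hv, absurd hvZ h'.1]
      · rw [hoff v h]; exact hZ v hvZ hv
  by_cases hxy : s x = s y
  · obtain ⟨p, hpG, hxp, hpy⟩ := hlink x y hxy
    obtain ⟨-, hp1, hp2, hp3, hp4⟩ := hGmem p hpG
    obtain ⟨σ', h1, h2, h3⟩ := exists_rewire_four hσ hx hy hyx hp1 hsymm hxp hpy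
    refine hfinish σ' _ (Finset.card_le_four.trans (by norm_num)) h1 h2 h3 ?_ (by simp) (by simp)
    intro v hv
    simp only [Finset.mem_insert, Finset.mem_singleton] at hv
    rcases hv with rfl | rfl | rfl | rfl
    exacts [Or.inl rfl, Or.inr (Or.inr ⟨hp2, hp1⟩), Or.inr (Or.inl rfl),
      Or.inr (Or.inr ⟨hp3, by rw [hσ p]; exact hp1.symm⟩)]
  · obtain ⟨c, hcG⟩ : ({v ∈ G | Adj y v} : Finset V).Nonempty := by
      rw [← Finset.card_pos]
      have := hgood y
      omega
    rw [Finset.mem_filter] at hcG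
    obtain ⟨hcG, hyc⟩ := hcG
    obtain ⟨-, hc1, hc2, hc3, hc4⟩ := hGmem c hcG
    have hcc := hσ c
    have hsy := hcross _ _ hyc
    have hsxc : s x = s (σ c) := by
      rw [hc4]
      revert hxy hsy
      cases s x <;> cases s y <;> cases s c <;> simp
    obtain ⟨p, hpG, hxp, hpc⟩ := hlink x (σ c) hsxc
    obtain ⟨-, hp1, hp2, hp3, hp4⟩ := hGmem p hpG
    have hsx := hcross _ _ hxp
    have hpc1 : s p ≠ s c := fun h => hsx (by rw [hsxc, hc4, h])
    obtain ⟨σ', h1, h2, h3⟩ := exists_rewire_six hσ hx hy hyx hp1 hc1 (fun h => hpc1 (by rw [h]))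
      (fun h => hpc1 (by rw [h, hc4])) hsymm hxp hpc hyc
    refine hfinish σ' _ Finset.card_le_six h1 h2 h3 ?_ (by simp) (by simp)
    intro v hv
    simp only [Finset.mem_insert, Finset.mem_singleton] at hv
    rcases hv with rfl | rfl | rfl | rfl | rfl | rfl
    exacts [Or.inl rfl, Or.inr (Or.inr ⟨hp2, hp1⟩), Or.inr (Or.inl rfl),
      Or.inr (Or.inr ⟨hc2, hc1⟩), Or.inr (Or.inr ⟨hp3, by rw [hσ p]; exact hp1.symm⟩),
      Or.inr (Or.inr ⟨hc3, by rw [hσ c]; exact hc1.symm⟩)]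

/-- If a bipartite multigraph of multiplicity at most `r` still has `r * q` edges at `v` that are
not used by the family `T`, then `v` has at least `q` neighbours along unused edges. -/
lemma le_card_unused_neighbors {V : Type*} [Fintype V] [DecidableEq V] {s : V → Bool}
    {W : V → V → ℕ} (hcross : ∀ u v, s u = s v → W u v = 0) {r : ℕ} (hr0 : 0 < r)
    (hr : ∀ u v, W u v ≤ r) {q : ℕ} {T : Multiset (V → V)} {v : V}
    (h : r * q + crossCount s T v ≤ ∑ u, W v u) :
    q ≤ #{u | s v ≠ s u ∧ useCount T v u < W v u} := by
  have h1 : ∑ u, W v u ≤ ∑ u, ((if s v ≠ s u ∧ useCount T v u < W v u then r else 0) +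
      crossPart s (useCount T) v u) := by
    refine Finset.sum_le_sum fun u _ => ?_
    have := hr v u
    by_cases hs : s v = s u
    · simp [hcross v u hs]
    · by_cases hu : useCount T v u < W v u
      · simp only [ne_eq, hs, not_false_eq_true, hu, and_self, if_true]
        omega
      · simp only [ne_eq, hs, not_false_eq_true, hu, and_false, if_false, crossPart]
        omega
  rw [Finset.sum_add_distrib, sum_crossPart_useCount, ← Finset.sum_filter, Finset.sum_const,
    smul_eq_mul, mul_comm _ r] at h1
  exact Nat.le_of_mul_le_mul_left (by omega) hr0

/-- A family of matchings inside the classes of a balanced bipartition, each missing few vertices,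
is turned into a family of perfect matchings by means of a dense bipartite multigraph between the
classes, so that the edges used between the classes are evenly spread. -/
lemma exists_perfect_family_of_few_fixed {V : Type*} [Fintype V] [DecidableEq V] {s : V → Bool}
    {n : ℕ} (hs : ∀ b, #{v | s v = b} = n) (hV : Even (Fintype.card V)) {W : V → V → ℕ}
    (hsymm : ∀ u v, W u v = W v u) (hcross : ∀ u v, s u = s v → W u v = 0) {r : ℕ} (hr0 : 0 < r)
    (hr : ∀ u v, W u v ≤ r) {q b t z : ℕ} (ht : 0 < t) (hb : n + 2 * (2 * z + b) < 2 * q)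
    (L : Multiset (V → V))
    (hL : ∀ σ ∈ L, Function.Involutive σ ∧ (∀ v, s (σ v) = s v) ∧ 3 * #{v | σ v = v} ≤ b)
    (hz : L.card * b ≤ z * t) (hdeg : ∀ v, r * q + useCount L v v + t ≤ ∑ u, W v u) :
    ∃ T : Multiset (V → V), T.card = L.card ∧
      (∀ τ ∈ T, Function.Involutive τ ∧ ∀ v, τ v ≠ v) ∧
      (∀ u v, u ≠ v → s u = s v → useCount T u v ≤ useCount L u v) ∧
      (∀ u v, s u ≠ s v → useCount T u v ≤ W u v) ∧
      (∀ v, crossCount s T v ≤ useCount L v v + t) ∧ ∑ v, crossCount s T v ≤ L.card * b := by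
  induction L using Multiset.induction_on with
  | empty => exact ⟨0, by simp⟩
  | cons σ L ih =>
    simp only [Multiset.card_cons, Nat.succ_mul] at hz
    obtain ⟨T, hTc, hT, hTin, hTcr, hTbal, hTsum⟩ :=
      ih (fun τ hτ => hL τ (Multiset.mem_cons_of_mem hτ)) (by omega) (fun v => by
        have := hdeg v
        rw [useCount_cons] at this
        omega)
    obtain ⟨hσ, hside, hfix⟩ := hL σ (Multiset.mem_cons_self _ _)
    set Z : Finset V := {v | useCount L v v + t ≤ crossCount s T v} with hZ
    have hZc : #Z ≤ z := by
      have h1 : #Z * t ≤ ∑ v, crossCount s T v := by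
        rw [← smul_eq_mul, ← Finset.sum_const]
        refine (Finset.sum_le_sum fun v hv => ?_).trans
          (Finset.sum_le_sum_of_subset (Finset.subset_univ Z))
        simp only [hZ, Finset.mem_filter, Finset.mem_univ, true_and] at hv
        omega
      exact Nat.le_of_mul_le_mul_right (by omega : #Z * t ≤ z * t) ht
    have hTinv : ∀ τ ∈ T, Function.Involutive τ := fun τ hτ => (hT τ hτ).1
    obtain ⟨τ, hτ, hτfree, hτAdj, hτZ, hτc⟩ := exists_perfect_of_few_fixed hs hV
      (fun u v => s u ≠ s v ∧ useCount T u v < W u v)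
      (fun u v h => ⟨h.1.symm, by rw [useCount_comm hTinv, hsymm]; exact h.2⟩)
      (fun u v h => h.1) (q := q) (fun v => le_card_unused_neighbors hcross hr0 hr (by
        have := hdeg v
        have := hTbal v
        rw [useCount_cons] at *
        omega)) Z (b := b) (by omega) hσ hside hfix
    refine ⟨τ ::ₘ T, by simp [hTc], ?_, ?_, ?_, ?_, ?_⟩
    · intro τ' hτ'
      rcases Multiset.mem_cons.1 hτ' with rfl | h
      exacts [⟨hτ, hτfree⟩, hT τ' h]
    · intro u v huv hsuv
      rw [useCount_cons, useCount_cons]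
      refine Nat.add_le_add (hTin u v huv hsuv) ?_
      rcases hτAdj u with h | h
      · rw [h]
      · rw [if_neg fun h' => h.1 (by rw [h', hsuv])]
        exact Nat.zero_le _
    · intro u v hsuv
      rw [useCount_cons]
      have h0 := hTcr u v hsuv
      split_ifs with h
      · subst h
        rcases hτAdj u with h | h
        · exact absurd (by rw [h, hside]) hsuv
        · exact h.2
      · simpa using h0
    · intro v
      rw [crossCount_cons, useCount_cons]
      have h0 := hTbal v
      by_cases h : s (τ v) ≠ s v
      · rw [if_pos h]
        by_cases hvZ : v ∈ Z
        · by_cases hσv : σ v = v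
          · rw [if_pos hσv]
            omega
          · exact absurd (by rw [hτZ v hvZ hσv, hside]) h
        · simp only [hZ, Finset.mem_filter, Finset.mem_univ, true_and] at hvZ
          omega
      · rw [if_neg h]
        omega
    · simp only [crossCount_cons, Finset.sum_add_distrib, Multiset.card_cons, Nat.succ_mul]
      refine Nat.add_le_add hTsum (le_trans ?_ hτc)
      rw [← Finset.sum_filter, Finset.sum_const, smul_eq_mul, mul_one]
      refine Finset.card_le_card fun v hv => ?_
      simp only [Finset.mem_filter, Finset.mem_univ, true_and] at hv ⊢
      exact fun h => hv (by rw [h, hside])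

/-- A multigraph with edges inside both classes of a bipartition contains a matching consisting of
one edge in each class. -/
lemma exists_involution_one_edge_per_class {V : Type*} [Fintype V] [DecidableEq V] {s : V → Bool}
    {m : V → V → ℕ} (hsymm : ∀ u v, m u v = m v u) (hdiag : ∀ v, m v v = 0)
    (hside : ∀ u v, s u ≠ s v → m u v = 0) (hne : ∀ b, ∃ u, s u = b ∧ ∃ v, 0 < m u v) :
    ∃ ρ : V → V, Function.Involutive ρ ∧ (∀ v, s (ρ v) = s v) ∧
      (∀ v, ρ v ≠ v → 0 < m v (ρ v)) ∧ ∀ b, #{v | s v = b ∧ ρ v ≠ v} = 2 := by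
  choose u hu w hw using hne
  have huw : ∀ b, u b ≠ w b := fun b h => by
    have := hw b
    rw [← h, hdiag] at this
    exact this.false
  have hsw : ∀ b, s (w b) = b := fun b => by
    by_contra h
    have := hw b
    rw [hside _ _ (by rw [hu]; exact Ne.symm h)] at this
    exact this.false
  have hs : ∀ v, s (Equiv.swap (u (s v)) (w (s v)) v) = s v := by
    intro v
    rw [Equiv.swap_apply_def]
    split_ifs
    exacts [hsw _, hu _, rfl]
  refine ⟨fun v => Equiv.swap (u (s v)) (w (s v)) v, fun v => ?_, hs, fun v hv => ?_, fun b => ?_⟩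
  · simp only [hs, Equiv.swap_apply_self]
  · dsimp only at hv ⊢
    rw [Equiv.swap_apply_def] at hv ⊢
    split_ifs at hv ⊢ with h1 h2
    · conv_rhs => rw [h1]
      rw [hu]
      exact hw _
    · conv_rhs => rw [h2]
      rw [hsw, hsymm]
      exact hw _
    · exact absurd rfl hv
  · rw [← Finset.card_pair (huw b)]
    congr 1
    ext v
    simp only [Finset.mem_filter, Finset.mem_univ, true_and, Finset.mem_insert,
      Finset.mem_singleton]
    constructor
    · rintro ⟨rfl, h⟩
      by_contra! hcon
      exact h (Equiv.swap_apply_of_ne_of_ne hcon.1 hcon.2)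
    · rintro (rfl | rfl)
      · refine ⟨hu b, ?_⟩
        rw [hu, Equiv.swap_apply_left]
        exact (huw b).symm
      · refine ⟨hsw b, ?_⟩
        rw [hsw, Equiv.swap_apply_right]
        exact huw b

lemma sum_map_card_moved_le {V : Type*} [DecidableEq V] (L : Multiset (V → V))
    (A : Finset V) {Δ : ℕ} (h : ∀ v, L.card ≤ useCount L v v + Δ) :
    (L.map fun σ => #{v ∈ A | σ v ≠ v}).sum ≤ #A * Δ := by
  have h1 : (L.map fun σ => #{v ∈ A | σ v ≠ v}).sum + ∑ v ∈ A, useCount L v v =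
      #A * L.card := by
    clear h
    induction L using Multiset.induction_on with
    | empty => simp
    | cons σ L ih =>
      have := Finset.card_filter_add_card_filter_not (s := A) (fun v => σ v = v)
      simp only [Multiset.map_cons, Multiset.sum_cons, useCount_cons, Finset.sum_add_distrib,
        Multiset.card_cons, mul_add, mul_one, ← ih, Finset.sum_boole, Nat.cast_id, ne_eq]
      simp only [ne_eq] at ih
      omega
  have h2 : #A * L.card ≤ ∑ v ∈ A, useCount L v v + #A * Δ := by
    rw [← smul_eq_mul, ← smul_eq_mul (#A) Δ, ← Finset.sum_const, ← Finset.sum_const,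
      ← Finset.sum_add_distrib]
    exact Finset.sum_le_sum fun v _ => h v
  omega

/-- Adjoining to a matching another one that is disjoint from it. -/
lemma involutive_ite_of_disjoint {V : Type*} [DecidableEq V] {σ ρ : V → V}
    (hσ : Function.Involutive σ) (hρ : Function.Involutive ρ) (h : ∀ v, ρ v ≠ v → σ v = v) :
    Function.Involutive (fun v => if ρ v = v then σ v else ρ v) := by
  intro v
  by_cases hv : ρ v = v
  · have h1 : ρ (σ v) = σ v := by
      by_contra hne
      have := hσ.injective (h _ hne)
      exact hne (by rw [this, hv])
    simp [hv, h1, hσ v]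
  · have h1 : ρ (ρ v) ≠ ρ v := by
      rw [hρ v]
      exact Ne.symm hv
    simp only [hv, if_false, h1]
    exact hρ v

/-- A sparse multigraph inside the classes of a bipartition, with equally many edges in both
classes, is decomposed into few small matchings, each with equally many edges in both classes. -/
lemma exists_balanced_matchings {V : Type*} [Fintype V] [DecidableEq V] {s : V → Bool}
    {Δ c K : ℕ} (hK : 4 * c * Δ + Fintype.card V * Δ < K * c) (m : V → V → ℕ)
    (hsymm : ∀ u v, m u v = m v u) (hdiag : ∀ v, m v v = 0)
    (hside : ∀ u v, s u ≠ s v → m u v = 0) (hdeg : ∀ v, ∑ u, m v u ≤ Δ)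
    (hbal : ∑ v with s v = true, ∑ u, m v u = ∑ v with s v = false, ∑ u, m v u) :
    ∃ L : Multiset (V → V), L.card = K ∧
      (∀ σ ∈ L, Function.Involutive σ ∧ (∀ v, s (σ v) = s v) ∧
        #{v | s v = true ∧ σ v ≠ v} = #{v | s v = false ∧ σ v ≠ v} ∧
        #{v | σ v ≠ v} ≤ c + 3) ∧
      ∀ u v, u ≠ v → useCount L u v = m u v := by
  induction hN : ∑ v, ∑ u, m v u using Nat.strong_induction_on generalizing m with
  | _ N ih =>
  by_cases hzero : ∀ u v, m u v = 0
  · refine ⟨Multiset.replicate K id, by simp, fun σ hσ => ?_, fun u v huv => ?_⟩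
    · rw [Multiset.eq_of_mem_replicate hσ]
      exact ⟨fun _ => rfl, fun _ => rfl, by simp, by simp⟩
    · rw [hzero]
      exact Multiset.countP_eq_zero.2 fun σ hσ => by
        rw [Multiset.eq_of_mem_replicate hσ]
        exact huv
  have hne : ∀ b, ∃ u, s u = b ∧ ∃ v, 0 < m u v := by
    have hsum : ∀ b, (∃ u, s u = b ∧ ∃ v, 0 < m u v) ↔ ∑ v with s v = b, ∑ u, m v u ≠ 0 := by
      intro b
      simp [Finset.sum_eq_zero_iff, Nat.pos_iff_ne_zero]
    push Not at hzero
    obtain ⟨u, v, huv⟩ := hzero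
    have hu := (hsum (s u)).1 ⟨u, rfl, v, Nat.pos_of_ne_zero huv⟩
    intro b
    rw [hsum]
    cases b <;> cases h : s u <;> rw [h] at hu <;> omega
  obtain ⟨ρ, hρ, hρs, hρm, hρ2⟩ := exists_involution_one_edge_per_class hsymm hdiag hside hne
  set I : V → V → ℕ := fun u v => if u ≠ v ∧ ρ u = v then 1 else 0 with hI
  have hIm : ∀ u v, I u v ≤ m u v := by
    intro u v
    simp only [hI]
    split_ifs with h
    · obtain ⟨h1, rfl⟩ := h
      exact hρm u h1.symm
    · exact Nat.zero_le _
  have hsub : ∀ u v, m u v - I u v + I u v = m u v := fun u v => Nat.sub_add_cancel (hIm u v)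
  have hIrow : ∀ v, ∑ u, I v u = if ρ v ≠ v then 1 else 0 := by
    intro v
    by_cases h : ρ v = v
    · rw [if_neg (not_not.2 h)]
      refine Finset.sum_eq_zero fun u _ => if_neg ?_
      rintro ⟨h1, h2⟩
      exact h1 (h.symm.trans h2)
    · rw [if_pos h, Finset.sum_eq_single (ρ v)]
      · simp [hI, Ne.symm h]
      · intro u _ hu
        exact if_neg fun h' => hu h'.2.symm
      · simp
  have hrow : ∀ v, ∑ u, (m v u - I v u) + ∑ u, I v u = ∑ u, m v u := by
    intro v
    rw [← Finset.sum_add_distrib]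
    exact Finset.sum_congr rfl fun u _ => hsub v u
  have hcls : ∀ b, ∑ v with s v = b, ∑ u, (m v u - I v u) + 2 = ∑ v with s v = b, ∑ u, m v u := by
    intro b
    rw [← hρ2 b, ← Finset.filter_filter, Finset.card_filter, ← Finset.sum_add_distrib]
    refine Finset.sum_congr rfl fun v _ => ?_
    rw [← hIrow]
    exact hrow v
  have htot : ∀ w : V → V → ℕ, ∑ v, ∑ u, w v u =
      ∑ v with s v = true, ∑ u, w v u + ∑ v with s v = false, ∑ u, w v u := by
    intro w
    rw [← Finset.sum_filter_add_sum_filter_not _ (fun v => s v = true)]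
    simp
  have hdeg' : ∀ v, ∑ u, (m v u - I v u) ≤ Δ := fun v => by
    have := hrow v
    have := hdeg v
    omega
  obtain ⟨L, hLc, hL, hLm⟩ := ih (∑ v, ∑ u, (m v u - I v u))
    (by
      rw [← hN, htot, htot m]
      have := hcls true
      have := hcls false
      omega) (fun u v => m u v - I u v)
    (fun u v => by
      rw [hsymm]
      congr 1
      simp only [hI]
      congr 1
      refine propext ⟨?_, ?_⟩ <;> rintro ⟨h1, rfl⟩ <;> exact ⟨h1.symm, hρ _⟩)
    (fun v => by simp [hdiag]) (fun u v h => by simp [hside u v h]) hdeg'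
    (by
      have := hcls true
      have := hcls false
      omega) rfl
  have hmoved : ∀ v, L.card ≤ useCount L v v + Δ := by
    intro v
    rw [← sum_useCount L v, ← Finset.add_sum_erase _ _ (Finset.mem_univ v)]
    refine Nat.add_le_add_left (le_trans ?_ (hdeg' v)) _
    refine le_trans (Finset.sum_le_sum fun u hu => (hLm v u (Finset.ne_of_mem_erase hu).symm).le) ?_
    exact Finset.sum_le_sum_of_subset (Finset.subset_univ _)
  obtain ⟨σ, hσL, hσρ, hσc⟩ : ∃ σ ∈ L, (∀ v, ρ v ≠ v → σ v = v) ∧ #{v | σ v ≠ v} < c := by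
    by_contra! hcon
    set S : Finset V := {v | ρ v ≠ v} with hS
    have hSc : #S = 4 := by
      rw [hS, Finset.card_filter, ← Finset.sum_filter_add_sum_filter_not _ (fun v => s v = true),
        ← Finset.card_filter, ← Finset.card_filter, Finset.filter_filter, Finset.filter_filter,
        hρ2]
      simp [hρ2]
    have h1 : L.card * c ≤
        (L.map fun σ => c * #{v ∈ S | σ v ≠ v} + #{v ∈ (univ : Finset V) | σ v ≠ v}).sum := by
      rw [← smul_eq_mul, ← Multiset.card_map]
      refine Multiset.card_nsmul_le_sum fun x hx => ?_
      obtain ⟨σ, hσ, rfl⟩ := Multiset.mem_map.1 hx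
      by_cases h : ∀ v, ρ v ≠ v → σ v = v
      · exact (hcon σ hσ h).trans (Nat.le_add_left _ _)
      · push Not at h
        obtain ⟨v, hv1, hv2⟩ := h
        have : 0 < #{v ∈ S | σ v ≠ v} :=
          Finset.card_pos.2 ⟨v, by simp [hS, hv1, hv2]⟩
        exact (Nat.le_mul_of_pos_right c this).trans (Nat.le_add_right _ _)
    rw [Multiset.sum_map_add, Multiset.sum_map_mul_left, hLc] at h1
    have h2 := sum_map_card_moved_le L S hmoved
    have h3 := sum_map_card_moved_le L univ hmoved
    rw [hSc] at h2
    rw [Finset.card_univ] at h3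
    have h4 := Nat.mul_le_mul_left c h2
    have h5 : c * (4 * Δ) = 4 * c * Δ := by ring
    omega
  obtain ⟨L₀, rfl⟩ := Multiset.exists_cons_of_mem hσL
  obtain ⟨hσ, hσs, hσb, -⟩ := hL σ hσL
  have hcount : ∀ b, #{v | s v = b ∧ (if ρ v = v then σ v else ρ v) ≠ v} =
      #{v | s v = b ∧ σ v ≠ v} + 2 := by
    intro b
    rw [← hρ2 b, ← Finset.card_union_of_disjoint]
    · congr 1
      ext v
      simp only [Finset.mem_filter, Finset.mem_univ, true_and, Finset.mem_union]
      by_cases h : ρ v = v <;> simp [h, hσρ v]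
    · rw [Finset.disjoint_left]
      intro v h1 h2
      simp only [Finset.mem_filter, Finset.mem_univ, true_and] at h1 h2
      exact h1.2 (hσρ v h2.2)
  have hsplit : ∀ f : V → V, #{v | f v ≠ v} =
      #{v | s v = true ∧ f v ≠ v} + #{v | s v = false ∧ f v ≠ v} := by
    intro f
    rw [← Finset.card_filter_add_card_filter_not (s := ({v | f v ≠ v} : Finset V))
      (fun v => s v = true), Finset.filter_filter, Finset.filter_filter]
    simp [and_comm]
  refine ⟨(fun v => if ρ v = v then σ v else ρ v) ::ₘ L₀, by simpa using hLc, ?_, ?_⟩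
  · intro τ hτ
    rcases Multiset.mem_cons.1 hτ with rfl | h
    · refine ⟨involutive_ite_of_disjoint hσ hρ hσρ, fun v => ?_, ?_, ?_⟩
      · dsimp only
        split_ifs
        exacts [hσs v, hρs v]
      · rw [hcount, hcount, hσb]
      · rw [hsplit, hcount, hcount]
        have := hsplit σ
        omega
    · exact hL τ (Multiset.mem_cons_of_mem h)
  · intro u v huv
    have h1 := hLm u v huv
    have h2 := hsub u v
    rw [useCount_cons] at h1 ⊢
    rw [← h2, ← h1, add_assoc]
    congr 1
    simp only [hI]
    by_cases h : ρ u = u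
    · simp [h, huv]
    · simp [h, huv, hσρ u h]

/-- A small matching inside the classes of a balanced bipartition that misses equally many vertices
in both classes extends to a perfect matching by edges of a dense bipartite graph between the
classes. -/
lemma exists_perfect_extension {V : Type*} [Fintype V] [DecidableEq V] {s : V → Bool} {n : ℕ}
    (hs : ∀ b, #{v | s v = b} = n) (Adj : V → V → Prop) [DecidableRel Adj]
    (hsymm : ∀ u v, Adj u v → Adj v u) (hcross : ∀ u v, Adj u v → s u ≠ s v)
    {q : ℕ} (hq : ∀ u, q ≤ #{v | Adj u v}) {σ : V → V} (hσ : Function.Involutive σ)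
    (hbal : #{v | s v = true ∧ σ v ≠ v} = #{v | s v = false ∧ σ v ≠ v})
    (hmoved : n + 2 * #{v | σ v ≠ v} ≤ 2 * q) :
    ∃ τ : V → V, Function.Involutive τ ∧ (∀ v, τ v ≠ v) ∧
      ∀ v, if σ v = v then Adj v (τ v) else τ v = σ v := by
  set A : Bool → Finset V := fun b => {v | s v = b ∧ σ v = v} with hA
  have hAn : ∀ b, #(A b) + #{v | s v = b ∧ σ v ≠ v} = n := by
    intro b
    rw [← hs b, ← Finset.card_filter_add_card_filter_not (s := ({v | s v = b} : Finset V))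
      (fun v => σ v = v), Finset.filter_filter, Finset.filter_filter]
  have hAA : #(A true) = #(A false) := by
    have := hAn true
    have := hAn false
    omega
  have hnbr : ∀ u, q ≤ #{v ∈ A (!s u) | Adj u v} + #{v | σ v ≠ v} := by
    intro u
    refine (hq u).trans ((Finset.card_le_card fun v hv => ?_).trans (Finset.card_union_le _ _))
    simp only [Finset.mem_filter, Finset.mem_univ, true_and, Finset.mem_union, hA] at hv ⊢
    have := Bool.eq_not_of_ne (hcross u v hv).symm
    tauto
  obtain ⟨f, hf, hft⟩ := (Finset.all_card_le_biUnion_card_iff_exists_injective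
    (fun a : {a // s a = true ∧ σ a = a} => ({v ∈ A false | Adj a v} : Finset V))).1 (fun X => by
      rcases X.eq_empty_or_nonempty with rfl | ⟨a, ha⟩
      · simp
      have hsub := Finset.subset_biUnion_of_mem
        (fun a : {a // s a = true ∧ σ a = a} => ({v ∈ A false | Adj a v} : Finset V)) ha
      have ha' := hnbr a
      rw [a.2.1] at ha'
      by_cases hX : #X + #{v | σ v ≠ v} ≤ q
      · refine le_trans ?_ (Finset.card_le_card hsub)
        simp only [Bool.not_true] at ha'
        omega
      have hXA : X.map (Function.Embedding.subtype _) ⊆ A true := by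
        intro v hv
        obtain ⟨a, -, rfl⟩ := Finset.mem_map.1 hv
        simpa [hA] using a.2
      have hXc := Finset.card_le_card hXA
      rw [Finset.card_map, hAA] at hXc
      refine hXc.trans (Finset.card_le_card fun v hv => ?_)
      have hv' := hnbr v
      have hsv : s v = false := by simpa [hA] using (Finset.mem_filter.1 hv).2.1
      rw [hsv] at hv'
      have hne : (X.map (Function.Embedding.subtype _) ∩
          ({u ∈ A true | Adj v u} : Finset V)).Nonempty := by
        refine Finset.inter_nonempty_of_card_lt_card_add_card hXA (Finset.filter_subset _ _) ?_
        rw [Finset.card_map]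
        have := hAn true
        simp only [Bool.not_false] at hv'
        omega
      obtain ⟨u, hu⟩ := hne
      rw [Finset.mem_inter, Finset.mem_map, Finset.mem_filter] at hu
      obtain ⟨⟨a, haX, rfl⟩, -, hav⟩ := hu
      exact Finset.mem_biUnion.2 ⟨a, haX, Finset.mem_filter.2 ⟨hv, hsymm _ _ hav⟩⟩)
  have hfA : ∀ a, s (f a) = false ∧ σ (f a) = f a ∧ Adj a (f a) := by
    intro a
    have := hft a
    simpa [hA, and_assoc] using this
  have hsurj : ∀ v ∈ A false, ∃ a, f a = v := by
    have h1 : univ.image f ⊆ A false := by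
      intro v hv
      obtain ⟨a, -, rfl⟩ := Finset.mem_image.1 hv
      exact (Finset.mem_filter.1 (hft a)).1
    have h2 := Finset.eq_of_subset_of_card_le h1 (by
      rw [Finset.card_image_of_injective _ hf, Finset.card_univ, Fintype.card_subtype, ← hAA])
    intro v hv
    rw [← h2] at hv
    simpa using hv
  set τ : V → V := fun v => if h : s v = true ∧ σ v = v then f ⟨v, h⟩ else
    if h : ∃ a, f a = v then (h.choose : V) else σ v with hτ
  have hτ1 : ∀ a : {a // s a = true ∧ σ a = a}, τ a = f a := fun a => dif_pos a.2
  have hτ2 : ∀ a, τ (f a) = a := by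
    intro a
    have h1 : ¬ (s (f a) = true ∧ σ (f a) = f a) := by simp [(hfA a).1]
    have h2 : ∃ a', f a' = f a := ⟨a, rfl⟩
    simp only [hτ, dif_neg h1, dif_pos h2]
    rw [hf h2.choose_spec]
  have hτ3 : ∀ v, σ v ≠ v → τ v = σ v := by
    intro v hv
    have h2 : ¬ ∃ a, f a = v := by
      rintro ⟨a, rfl⟩
      exact hv (hfA a).2.1
    simp only [hτ, dif_neg h2, hv, and_false, dite_false]
  have hcases : ∀ v : V, (∃ a : {a // s a = true ∧ σ a = a}, v = a) ∨
      (∃ a, v = f a) ∨ σ v ≠ v := by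
    intro v
    by_cases hv : σ v = v
    · cases hsv : s v
      · obtain ⟨a, ha⟩ := hsurj v (by simp [hA, hsv, hv])
        exact Or.inr (Or.inl ⟨a, ha.symm⟩)
      · exact Or.inl ⟨⟨v, hsv, hv⟩, rfl⟩
    · exact Or.inr (Or.inr hv)
  have hne : ∀ a, f a ≠ a := fun a h => by
    have := (hfA a).1
    rw [h, a.2.1] at this
    cases this
  refine ⟨τ, fun v => ?_, fun v => ?_, fun v => ?_⟩
  · rcases hcases v with ⟨a, rfl⟩ | ⟨a, rfl⟩ | hv
    · rw [hτ1, hτ2]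
    · rw [hτ2, hτ1]
    · rw [hτ3 v hv, hτ3 _ (by rw [hσ v]; exact hv.symm), hσ v]
  · rcases hcases v with ⟨a, rfl⟩ | ⟨a, rfl⟩ | hv
    · rw [hτ1]; exact hne a
    · rw [hτ2]; exact (hne a).symm
    · rw [hτ3 v hv]; exact hv
  · rcases hcases v with ⟨a, rfl⟩ | ⟨a, rfl⟩ | hv
    · rw [if_pos a.2.2, hτ1]; exact (hfA a).2.2
    · rw [if_pos (hfA a).2.1, hτ2]; exact hsymm _ _ (hfA a).2.2
    · rw [if_neg hv, hτ3 v hv]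

/-- A family of small balanced matchings inside the classes of a balanced bipartition extends to a
family of perfect matchings by means of a dense bipartite multigraph between the classes. -/
lemma exists_perfect_family_extension {V : Type*} [Fintype V] [DecidableEq V] {s : V → Bool}
    {n : ℕ} (hs : ∀ b, #{v | s v = b} = n) {W : V → V → ℕ}
    (hsymm : ∀ u v, W u v = W v u) (hcross : ∀ u v, s u = s v → W u v = 0) {r : ℕ} (hr0 : 0 < r)
    (hr : ∀ u v, W u v ≤ r) {q k : ℕ} (hk : n + 2 * k ≤ 2 * q) (L : Multiset (V → V))
    (hL : ∀ σ ∈ L, Function.Involutive σ ∧ (∀ v, s (σ v) = s v) ∧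
      #{v | s v = true ∧ σ v ≠ v} = #{v | s v = false ∧ σ v ≠ v} ∧ #{v | σ v ≠ v} ≤ k)
    (hdeg : ∀ v, r * q + L.card ≤ ∑ u, W v u) :
    ∃ T : Multiset (V → V), T.card = L.card ∧
      (∀ τ ∈ T, Function.Involutive τ ∧ ∀ v, τ v ≠ v) ∧
      (∀ u v, u ≠ v → s u = s v → useCount T u v = useCount L u v) ∧
      ∀ u v, s u ≠ s v → useCount T u v ≤ W u v := by
  induction L using Multiset.induction_on with
  | empty => exact ⟨0, by simp⟩
  | cons σ L ih =>
    simp only [Multiset.card_cons] at hdeg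
    obtain ⟨T, hTc, hT, hTin, hTcr⟩ :=
      ih (fun τ hτ => hL τ (Multiset.mem_cons_of_mem hτ)) (fun v => by
        have := hdeg v
        omega)
    obtain ⟨hσ, hside, hbal, hmoved⟩ := hL σ (Multiset.mem_cons_self _ _)
    have hTinv : ∀ τ ∈ T, Function.Involutive τ := fun τ hτ => (hT τ hτ).1
    obtain ⟨τ, hτ, hτfree, hτσ⟩ := exists_perfect_extension hs
      (fun u v => s u ≠ s v ∧ useCount T u v < W u v)
      (fun u v h => ⟨h.1.symm, by rw [useCount_comm hTinv, hsymm]; exact h.2⟩)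
      (fun u v h => h.1) (q := q) (fun v => le_card_unused_neighbors hcross hr0 hr (by
        have := hdeg v
        have := crossCount_le_card s T v
        omega)) hσ hbal (by omega)
    refine ⟨τ ::ₘ T, by simp [hTc], ?_, ?_, ?_⟩
    · intro τ' hτ'
      rcases Multiset.mem_cons.1 hτ' with rfl | h
      exacts [⟨hτ, hτfree⟩, hT τ' h]
    · intro u v huv hsuv
      rw [useCount_cons, useCount_cons, hTin u v huv hsuv]
      congr 1
      have h := hτσ u
      split_ifs at h with h'
      · rw [if_neg fun h'' => h.1 (by rw [h'', hsuv]), if_neg fun h'' => huv (h'.symm.trans h'')]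
      · rw [h]
    · intro u v hsuv
      rw [useCount_cons]
      have h0 := hTcr u v hsuv
      split_ifs with h
      · subst h
        have h1 := hτσ u
        split_ifs at h1 with h'
        · exact h1.2
        · exact absurd (by rw [h1, hside]) hsuv
      · simpa using h0

lemma sum_sub_useCount_add_card {V : Type*} [Fintype V] [DecidableEq V] {m : V → V → ℕ}
    {T : Multiset (V → V)} (h : ∀ u v, useCount T u v ≤ m u v) (v : V) :
    ∑ u, (m v u - useCount T v u) + T.card = ∑ u, m v u := by
  rw [← sum_useCount T v, ← Finset.sum_add_distrib]
  exact Finset.sum_congr rfl fun u _ => Nat.sub_add_cancel (h v u)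

lemma sum_insidePart_sub_useCount {V : Type*} [Fintype V] [DecidableEq V] {m : V → V → ℕ}
    {T : Multiset (V → V)} (s : V → Bool) (h : ∀ u v, useCount T u v ≤ m u v) (v : V) :
    ∑ u, insidePart s (fun u v => m u v - useCount T u v) v u + T.card =
      ∑ u, insidePart s m v u + crossCount s T v := by
  rw [← sum_insidePart_useCount s T v, ← add_assoc, ← Finset.sum_add_distrib]
  congr 1
  refine Finset.sum_congr rfl fun u _ => ?_
  have := h v u
  simp only [insidePart]
  split_ifs <;> omega

lemma sum_crossPart_sub_useCount {V : Type*} [Fintype V] [DecidableEq V] {m : V → V → ℕ}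
    {T : Multiset (V → V)} (s : V → Bool) (h : ∀ u v, useCount T u v ≤ m u v) (v : V) :
    ∑ u, crossPart s (fun u v => m u v - useCount T u v) v u + crossCount s T v =
      ∑ u, crossPart s m v u := by
  rw [← sum_crossPart_useCount s T v, ← Finset.sum_add_distrib]
  refine Finset.sum_congr rfl fun u _ => ?_
  have := h v u
  simp only [crossPart]
  split_ifs <;> omega

/-- A regular multigraph has equally many edges inside both classes of a balanced bipartition. -/
lemma sum_insidePart_eq_of_regular {V : Type*} [Fintype V] {s : V → Bool} {n : ℕ}
    (hs : ∀ b, #{v | s v = b} = n) {m : V → V → ℕ} (hsymm : ∀ u v, m u v = m v u) {D : ℕ}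
    (hm : ∀ v, ∑ u, m v u = D) :
    ∑ v with s v = true, ∑ u, insidePart s m v u =
      ∑ v with s v = false, ∑ u, insidePart s m v u := by
  have htot : ∀ b, ∑ v with s v = b, ∑ u, insidePart s m v u +
      ∑ v with s v = b, ∑ u, crossPart s m v u = n * D := by
    intro b
    rw [← Finset.sum_add_distrib, ← hs b, ← smul_eq_mul, ← Finset.sum_const]
    refine Finset.sum_congr rfl fun v _ => ?_
    rw [← hm v]
    exact sum_insidePart_add_sum_crossPart s m v
  have hcr : ∀ b, ∑ v with s v = b, ∑ u, crossPart s m v u =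
      ∑ v with s v = b, ∑ u with s u = !b, m v u := by
    intro b
    refine Finset.sum_congr rfl fun v hv => ?_
    rw [Finset.sum_filter]
    refine Finset.sum_congr rfl fun u _ => ?_
    simp only [Finset.mem_filter, Finset.mem_univ, true_and] at hv
    subst hv
    unfold crossPart
    cases s v <;> cases s u <;> simp
  have h1 := htot true
  have h2 := htot false
  have h3 : ∑ v with s v = true, ∑ u with s u = false, m v u =
      ∑ v with s v = false, ∑ u with s u = true, m v u := by
    rw [Finset.sum_comm]
    exact Finset.sum_congr rfl fun v _ => Finset.sum_congr rfl fun u _ => hsymm u v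
  rw [hcr] at h1 h2
  simp only [Bool.not_true, Bool.not_false] at h1 h2
  omega

/-- Given a family of matchings that covers most of the edges inside the classes of a balanced
bipartition, a regular multigraph with many edges between the classes decomposes into perfect
matchings. -/
lemma exists_perfect_decomposition {V : Type*} [Fintype V] [DecidableEq V] {s : V → Bool}
    {n : ℕ} (hs : ∀ b, #{v | s v = b} = n) (hV : Fintype.card V = 2 * n) {m : V → V → ℕ}
    (hsymm : ∀ u v, m u v = m v u) (hdiag : ∀ v, m v v = 0) {r : ℕ} (hr0 : 0 < r)
    (hr : ∀ u v, m u v ≤ r) {d : ℕ} (hd : ∀ v, ∑ u, m v u = d)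
    {q b t z c K Δ : ℕ} (ht : 0 < t) (hb : n + 2 * (2 * z + b) < 2 * q)
    (hc : n + 2 * (c + 3) ≤ 2 * q) (hK : 4 * c * Δ + 2 * n * Δ < K * c)
    (L : Multiset (V → V))
    (hL : ∀ σ ∈ L, Function.Involutive σ ∧ (∀ v, s (σ v) = s v) ∧ 3 * #{v | σ v = v} ≤ b)
    (hLm : ∀ u v, u ≠ v → useCount L u v ≤ m u v)
    (hz : L.card * b ≤ z * t)
    (hin : ∀ v, ∑ u, insidePart s m v u + useCount L v v + t ≤ L.card + Δ)
    (hcross : ∀ v, r * q + useCount L v v + t + K ≤ ∑ u, crossPart s m v u) :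
    ∃ T : Multiset (V → V), (∀ τ ∈ T, Function.Involutive τ) ∧ ∀ u v, useCount T u v = m u v := by
  obtain ⟨T₁, hT₁c, hT₁, hT₁in, hT₁cr, hT₁v, -⟩ := exists_perfect_family_of_few_fixed hs
    (by rw [hV]; exact even_two_mul n) (crossPart_symm s hsymm)
    (fun u v h => by simp [crossPart, h]) hr0 (fun u v => (crossPart_le s m u v).trans (hr u v))
    ht hb L hL hz (fun v => by
      have := hcross v
      omega)
  have hT₁m : ∀ u v, useCount T₁ u v ≤ m u v := by
    intro u v
    by_cases huv : u = v
    · subst huv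
      rw [useCount_self_eq_zero fun τ hτ => (hT₁ τ hτ).2]
      exact Nat.zero_le _
    · by_cases hsuv : s u = s v
      · exact (hT₁in u v huv hsuv).trans (hLm u v huv)
      · exact (hT₁cr u v hsuv).trans (crossPart_le s m u v)
  set m₂ : V → V → ℕ := fun u v => m u v - useCount T₁ u v with hm₂
  have hm₂symm : ∀ u v, m₂ u v = m₂ v u := fun u v => by
    simp only [hm₂]
    rw [hsymm, useCount_comm fun τ hτ => (hT₁ τ hτ).1]
  have hm₂diag : ∀ v, m₂ v v = 0 := fun v => by simp [hm₂, hdiag]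
  have hm₂d : ∀ v, ∑ u, m₂ v u = d - T₁.card := fun v => by
    rw [← hd v, ← sum_sub_useCount_add_card hT₁m v, Nat.add_sub_cancel]
  obtain ⟨L₂, hL₂c, hL₂, hL₂m⟩ := exists_balanced_matchings (s := s) (Δ := Δ) (c := c) (K := K)
    (by rw [hV]; exact hK) (insidePart s m₂) (insidePart_symm s hm₂symm)
    (fun v => by simp [insidePart, hm₂diag]) (fun u v h => by simp [insidePart, h])
    (fun v => by
      have h1 : ∑ u, insidePart s m₂ v u + _ = _ := sum_insidePart_sub_useCount s hT₁m v
      have h2 := hT₁v v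
      have h3 := hin v
      omega) (sum_insidePart_eq_of_regular hs hm₂symm hm₂d)
  obtain ⟨T₂, hT₂c, hT₂, hT₂in, hT₂cr⟩ := exists_perfect_family_extension hs
    (crossPart_symm s hm₂symm) (fun u v h => by simp [crossPart, h]) hr0
    (fun u v => (crossPart_le s m₂ u v).trans ((Nat.sub_le _ _).trans (hr u v))) hc L₂ hL₂
    (fun v => by
      have h1 : ∑ u, crossPart s m₂ v u + _ = _ := sum_crossPart_sub_useCount s hT₁m v
      have h2 := hT₁v v
      have h3 := hcross v
      omega)
  have hT₂m : ∀ u v, useCount T₂ u v ≤ m₂ u v := by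
    intro u v
    by_cases huv : u = v
    · subst huv
      rw [useCount_self_eq_zero fun τ hτ => (hT₂ τ hτ).2]
      exact Nat.zero_le _
    · by_cases hsuv : s u = s v
      · rw [hT₂in u v huv hsuv, hL₂m u v huv]
        exact insidePart_le s m₂ u v
      · exact (hT₂cr u v hsuv).trans (crossPart_le s m₂ u v)
  set m₃ : V → V → ℕ := fun u v => m₂ u v - useCount T₂ u v with hm₃
  have hm₃d : ∀ v, ∑ u, m₃ v u = d - T₁.card - T₂.card := fun v => by
    rw [← hm₂d v, ← sum_sub_useCount_add_card hT₂m v, Nat.add_sub_cancel]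
  have hm₃diag : ∀ v, m₃ v v = 0 := fun v => by simp [hm₃, hm₂diag]
  obtain ⟨T₃, hT₃c, hT₃, hT₃m⟩ := exists_matchings_of_bipartite s m₃
    (fun u v => by
      simp only [hm₃]
      rw [hm₂symm, useCount_comm fun τ hτ => (hT₂ τ hτ).1])
    (fun u v h => by
      by_cases huv : u = v
      · rw [huv, hm₃diag]
      · simp [hm₃, hT₂in u v huv h, hL₂m u v huv, insidePart, h])
    (d - T₁.card - T₂.card) (fun v => (hm₃d v).le)
  have hT₃diag : ∀ v, useCount T₃ v v = m₃ v v := by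
    intro v
    have h1 := (sum_useCount T₃ v).trans (hT₃c.trans (hm₃d v).symm)
    rw [← Finset.add_sum_erase _ _ (Finset.mem_univ v),
      ← Finset.add_sum_erase _ (fun u => m₃ v u) (Finset.mem_univ v),
      Finset.sum_congr rfl fun u hu => hT₃m v u (Finset.ne_of_mem_erase hu).symm] at h1
    exact Nat.add_right_cancel h1
  refine ⟨T₁ + T₂ + T₃, fun τ hτ => ?_, fun u v => ?_⟩
  · rcases Multiset.mem_add.1 hτ with h | h
    · rcases Multiset.mem_add.1 h with h | h
      exacts [(hT₁ τ h).1, (hT₂ τ h).1]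
    · exact hT₃ τ h
  · have h3 : useCount T₃ u v = m₃ u v := by
      by_cases huv : u = v
      · subst huv; exact hT₃diag u
      · exact hT₃m u v huv
    have h1 := hT₁m u v
    have h2 := hT₂m u v
    rw [useCount_add, useCount_add, h3]
    simp only [hm₃, hm₂] at h2 ⊢
    omega

/-- The members of a family of maps with many fixed points are few if every point is fixed by few
members of the family. -/
lemma card_filter_fixed_mul_le {V : Type*} [Fintype V] [DecidableEq V] (L : Multiset (V → V))
    {φ b : ℕ} (hφ : ∀ v, useCount L v v ≤ φ) :
    (L.filter fun σ => ¬ 3 * #{v | σ v = v} ≤ b).card * b ≤ 3 * (Fintype.card V * φ) := by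
  have h1 : ∀ M : Multiset (V → V), (M.map fun σ => 3 * #{v | σ v = v}).sum =
      3 * ∑ v, useCount M v v := by
    intro M
    induction M using Multiset.induction_on with
    | empty => simp
    | cons σ M ih =>
      simp only [Multiset.map_cons, Multiset.sum_cons, ih, useCount_cons, Finset.sum_add_distrib,
        Finset.sum_boole, Nat.cast_id]
      ring
  have h2 : (L.filter fun σ => ¬ 3 * #{v | σ v = v} ≤ b).card * b ≤
      ((L.filter fun σ => ¬ 3 * #{v | σ v = v} ≤ b).map fun σ => 3 * #{v | σ v = v}).sum := by
    rw [← smul_eq_mul, ← Multiset.card_map (fun σ : V → V => 3 * #{v | σ v = v})]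
    refine Multiset.card_nsmul_le_sum fun x hx => ?_
    obtain ⟨σ, hσ, rfl⟩ := Multiset.mem_map.1 hx
    exact (not_le.1 (Multiset.mem_filter.1 hσ).2).le
  refine h2.trans ?_
  rw [h1]
  refine Nat.mul_le_mul_left 3 ?_
  rw [← Finset.card_univ, ← smul_eq_mul, ← Finset.sum_const]
  exact Finset.sum_le_sum fun v _ =>
    (useCount_mono (Multiset.filter_le _ _) v v).trans (hφ v)

lemma exists_indexed_useCount {V : Type*} [DecidableEq V] (T : Multiset (V → V)) :
    ∃ (k : ℕ) (g : Fin k → V → V), (∀ i, g i ∈ T) ∧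
      ∀ u v, ∑ i, (if g i u = v then 1 else 0) = useCount T u v := by
  induction T using Multiset.induction_on with
  | empty => exact ⟨0, Fin.elim0, by simp, by simp⟩
  | cons τ T ih =>
    obtain ⟨k, g, hg, hsum⟩ := ih
    refine ⟨k + 1, Fin.cons τ g, fun i => ?_, fun u v => ?_⟩
    · refine Fin.cases ?_ (fun i => ?_) i
      · simp
      · simp [hg i]
    · rw [Fin.sum_univ_succ, useCount_cons, ← hsum, add_comm]
      simp

lemma oneFactorizable_of_useCount_eq {V : Type*} [Fintype V] [DecidableEq V] {m : V → V → ℕ}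
    {T : Multiset (V → V)} (hT : ∀ τ ∈ T, Function.Involutive τ)
    (h : ∀ u v, useCount T u v = m u v) : OneFactorizable m := by
  obtain ⟨k, g, hg, hsum⟩ := exists_indexed_useCount T
  refine ⟨k, fun i u v => if g i u = v then 1 else 0,
    fun i => ⟨fun u v => ?_, fun u v => ?_, fun v => by simp⟩, fun u v => (hsum u v).trans (h u v)⟩
  · have := hT _ (hg i)
    have hiff : g i u = v ↔ g i v = u :=
      ⟨fun h => by rw [← h, this u], fun h => by rw [← h, this v]⟩
    simp only [hiff]
  · rw [← h, ← hsum]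
    exact Finset.single_le_sum (f := fun i => if g i u = v then 1 else 0)
      (fun _ _ => Nat.zero_le _) (Finset.mem_univ i)

lemma half_le_floor {x : ℝ} (hx : 2 ≤ x) : x / 2 ≤ (⌊x⌋₊ : ℝ) := by
  have := Nat.lt_floor_add_one x
  linarith

/-- A dense regular multigraph with a balanced bipartition that almost halves all degrees, and with
an almost optimal edge-colouring of almost all edges inside the classes, decomposes into perfect
matchings. -/
lemma exists_perfect_decomposition_of_dense {V : Type*} [Fintype V] [DecidableEq V]
    {s : V → Bool} {n : ℕ} (hs : ∀ b, #{v | s v = b} = n) (hV : Fintype.card V = 2 * n)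
    {m : V → V → ℕ} (hsymm : ∀ u v, m u v = m v u) (hdiag : ∀ v, m v v = 0) {r : ℕ} (hr0 : 0 < r)
    (hr : ∀ u v, m u v ≤ r) {d : ℕ} (hd : ∀ v, ∑ u, m v u = d) {e ρ β κ : ℝ}
    (he0 : 0 < e) (he1 : e ≤ 1) (hρ : ρ = e ^ 2 / 1000) (hβ : β = e * ρ / (1000 * r))
    (hκ : κ = β * ρ / 100) (hn : 2 ≤ β * n) (hed : (1 + e) * r * n ≤ (d : ℝ))
    (hcross : ∀ v, (d : ℝ) / 2 - κ * n ≤ ∑ u, (crossPart s m v u : ℝ))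
    (L : Multiset (V → V)) (hL : ∀ σ ∈ L, Function.Involutive σ)
    (hLm : ∀ u v, u ≠ v → useCount L u v ≤ insidePart s m u v)
    (hLc : (L.card : ℝ) ≤ 3 * r * n) (hfix : ∀ v, (useCount L v v : ℝ) ≤ κ * n)
    (hleft : ∀ v, (∑ u, insidePart s m v u : ℝ) + useCount L v v ≤ L.card + κ * n) :
    ∃ T : Multiset (V → V), (∀ τ ∈ T, Function.Involutive τ) ∧ ∀ u v, useCount T u v = m u v := by
  have hR : (1 : ℝ) ≤ r := by exact_mod_cast hr0
  have hρ0 : 0 < ρ := by rw [hρ]; positivity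
  have hρe : 1000 * ρ = e * e := by rw [hρ]; ring
  have hρe' : 1000 * ρ ≤ e := by nlinarith
  have hβ0 : 0 < β := by rw [hβ]; positivity
  have hβρ : 1000 * (r * β) = e * ρ := by rw [hβ]; field_simp
  have hβρ' : 1000 * β ≤ e * ρ := by nlinarith
  have hβρ'' : 1000 * β ≤ ρ := by nlinarith
  have hκ0 : 0 < κ := by rw [hκ]; positivity
  have hκβ : 100 * κ = β * ρ := by rw [hκ]; ring
  have hκρ : 100 * κ ≤ ρ := by nlinarith
  have hn0 : (0 : ℝ) < n := by
    by_contra h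
    nlinarith
  have hκn : 100 * (κ * n) ≤ ρ * n := by linarith [mul_le_mul_of_nonneg_right hκρ hn0.le]
  have hβn : 1000 * (β * n) ≤ ρ * n := by linarith [mul_le_mul_of_nonneg_right hβρ'' hn0.le]
  have hρen : 1000 * (ρ * n) ≤ e * n := by linarith [mul_le_mul_of_nonneg_right hρe' hn0.le]
  have hρn : 2000 ≤ ρ * n := by linarith
  have hen : 2000000 ≤ e * n := by linarith
  have hren : e * n ≤ r * (e * n) := le_mul_of_one_le_left (by positivity) hR
  set φ : ℕ := ⌊κ * n⌋₊ with hφ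
  set b : ℕ := ⌊β * n⌋₊ with hb
  set t : ℕ := ⌊ρ / 2 * n⌋₊ with ht
  set z : ℕ := ⌊e / 32 * n⌋₊ with hz
  set c : ℕ := ⌊e / 16 * n⌋₊ with hc
  set Δ : ℕ := ⌊ρ * n⌋₊ with hΔ
  set K : ℕ := ⌊e / 10 * n⌋₊ + 1 with hK
  set q : ℕ := ⌈(1 / 2 + e / 8) * n⌉₊ with hq
  have hφ1 : (φ : ℝ) ≤ κ * n := Nat.floor_le (by positivity)
  have hb1 : (b : ℝ) ≤ β * n := Nat.floor_le (by positivity)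
  have ht1 : (t : ℝ) ≤ ρ / 2 * n := Nat.floor_le (by positivity)
  have hz1 : (z : ℝ) ≤ e / 32 * n := Nat.floor_le (by positivity)
  have hc1 : (c : ℝ) ≤ e / 16 * n := Nat.floor_le (by positivity)
  have hΔ1 : (Δ : ℝ) ≤ ρ * n := Nat.floor_le (by positivity)
  have hK1 : (K : ℝ) ≤ e / 10 * n + 1 := by
    rw [hK]
    push_cast
    linarith [Nat.floor_le (by positivity : 0 ≤ e / 10 * n)]
  have hK2 : e / 10 * n < K := by
    rw [hK]
    push_cast
    exact Nat.lt_floor_add_one _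
  have hq1 : (1 / 2 + e / 8) * n ≤ (q : ℝ) := Nat.le_ceil _
  have hq2 : (q : ℝ) < (1 / 2 + e / 8) * n + 1 := Nat.ceil_lt_add_one (by positivity)
  have hb2 : β * n / 2 ≤ (b : ℝ) := half_le_floor hn
  have ht2 : ρ / 2 * n / 2 ≤ (t : ℝ) := half_le_floor (by linarith)
  have hz2 : e / 32 * n / 2 ≤ (z : ℝ) := half_le_floor (by linarith)
  have hc2 : e / 16 * n / 2 ≤ (c : ℝ) := half_le_floor (by linarith)
  have hφfix : ∀ v, useCount L v v ≤ φ := fun v => Nat.le_floor (hfix v)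
  have hφleft : ∀ v, ∑ u, insidePart s m v u + useCount L v v ≤ L.card + φ := by
    intro v
    rw [← Nat.sub_le_iff_le_add']
    refine Nat.le_floor ?_
    rcases le_total (∑ u, insidePart s m v u + useCount L v v) L.card with h | h
    · rw [Nat.sub_eq_zero_of_le h, Nat.cast_zero]
      positivity
    · rw [Nat.cast_sub h]
      push_cast
      linarith [hleft v]
  have hside : ∀ σ ∈ L, ∀ v, s (σ v) = s v := by
    intro σ hσ v
    by_contra h
    have h1 : 0 < useCount L v (σ v) := Multiset.countP_pos.2 ⟨σ, hσ, rfl⟩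
    have h2 := hLm v (σ v) fun h' => h (by rw [← h'])
    simp only [insidePart, Ne.symm h, if_false] at h2
    omega
  set P : (V → V) → Prop := fun σ => 3 * #{v | σ v = v} ≤ b with hP
  have hsplit : (L.filter P).card + (L.filter fun σ => ¬ P σ).card = L.card := by
    rw [← Multiset.card_add, Multiset.filter_add_not]
  set B : ℕ := (L.filter fun σ => ¬ P σ).card with hB
  have hBb : B * b ≤ 3 * (Fintype.card V * φ) := card_filter_fixed_mul_le L hφfix
  have hBρ : (B : ℝ) ≤ ρ * n / 4 := by
    rw [hV] at hBb
    have h1 : (B : ℝ) * b ≤ 3 * (2 * n * φ) := by exact_mod_cast hBb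
    have h2 : (B : ℝ) * (β * n / 2) ≤ B * b := by gcongr
    have h3 : (3 : ℝ) * (2 * n * φ) ≤ 3 * (2 * n * (κ * n)) := by gcongr
    have h4 : (B : ℝ) * (β * n / 2) ≤ ρ * n / 4 * (β * n / 2) := by
      refine (h2.trans (h1.trans h3)).trans ?_
      have h5 : 0 ≤ β * ρ * n * n := by positivity
      rw [hκ]
      linarith
    exact le_of_mul_le_mul_right h4 (by positivity)
  have hLf : L.filter P ≤ L := Multiset.filter_le _ _
  refine exists_perfect_decomposition hs hV hsymm hdiag hr0 hr hd (q := q) (b := b) (t := t)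
    (z := z) (c := c) (K := K) (Δ := Δ) ?_ ?_ ?_ ?_ (L.filter P) ?_ ?_ ?_ ?_ ?_
  · have : (0 : ℝ) < t := by linarith
    exact_mod_cast this
  · have : (n : ℝ) + 2 * (2 * z + b) < 2 * q := by linarith
    exact_mod_cast this
  · have : (n : ℝ) + 2 * (c + 3) ≤ 2 * q := by linarith
    exact_mod_cast this
  · have h1 : (4 : ℝ) * c * Δ + 2 * n * Δ ≤ (9 / 4) * (ρ * n * n) := by
      have h2 : (4 : ℝ) * c + 2 * n ≤ 9 / 4 * n := by
        linarith [mul_le_mul_of_nonneg_right he1 hn0.le]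
      calc (4 : ℝ) * c * Δ + 2 * n * Δ = (4 * c + 2 * n) * Δ := by ring
        _ ≤ (9 / 4 * n) * (ρ * n) := by gcongr
        _ = _ := by ring
    have h3 : e / 10 * n * (e / 16 * n / 2) < K * c := by
      have : 0 < e / 16 * n / 2 := by positivity
      calc e / 10 * n * (e / 16 * n / 2) < K * (e / 16 * n / 2) := by gcongr
        _ ≤ K * c := by gcongr
    have h4 : e / 10 * n * (e / 16 * n / 2) = (1000 / 320) * (ρ * n * n) := by
      rw [hρ]; ring
    have h5 : 0 < ρ * n * n := by positivity
    have : (4 : ℝ) * c * Δ + 2 * n * Δ < K * c := by linarith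
    exact_mod_cast this
  · intro σ hσ
    obtain ⟨h1, h2⟩ := Multiset.mem_filter.1 hσ
    exact ⟨hL σ h1, hside σ h1, h2⟩
  · exact fun u v huv => (useCount_mono hLf u v).trans
      ((hLm u v huv).trans (insidePart_le s m u v))
  · have h1 : ((L.filter P).card : ℝ) ≤ 3 * r * n := by
      have : ((L.filter P).card : ℝ) ≤ L.card := by exact_mod_cast Multiset.card_le_card hLf
      linarith
    have : ((L.filter P).card : ℝ) * b ≤ z * t := by
      calc ((L.filter P).card : ℝ) * b ≤ (3 * r * n) * (β * n) := by gcongr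
        _ = 3 / 1000 * (1000 * (r * β)) * (n * n) := by ring
        _ = 3 / 1000 * (e * ρ) * (n * n) := by rw [hβρ]
        _ ≤ (e / 32 * n / 2) * (ρ / 2 * n / 2) := by
          have : 0 ≤ e * ρ * n * n := by positivity
          linarith
        _ ≤ z * t := by gcongr
    exact_mod_cast this
  · intro v
    have h1 : φ + B + t ≤ Δ := by
      refine Nat.le_floor ?_
      push_cast
      linarith
    have h2 := hφleft v
    have h3 := useCount_mono hLf v v
    omega
  · intro v
    have h1 := hcross v
    have h2 : (useCount (L.filter P) v v : ℝ) ≤ κ * n := by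
      refine le_trans ?_ (hfix v)
      exact_mod_cast useCount_mono hLf v v
    have h3 : (r : ℝ) * q ≤ r * ((1 / 2 + e / 8) * n + 1) := by gcongr
    have h4 : (r : ℝ) * 2000000 ≤ r * (e * n) := by gcongr
    have : (r : ℝ) * q + useCount (L.filter P) v v + t + K ≤ ∑ u, (crossPart s m v u : ℝ) := by
      linarith
    exact_mod_cast this

/-- For all positive integers `r` and all `ε > 0`, there is `N = N(r, ε)` such that
for all `n ≥ N`, any regular multigraph of order `2n` with multiplicity at most `r`
and degree at least `(1+ε)·r·n` is 1-factorizable. -/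
theorem one_factorization_of_regular_multigraph
    (r : ℕ) (hr : 0 < r) (ε : ℝ) (hε : 0 < ε) :
    ∃ N : ℕ, ∀ n : ℕ, N ≤ n →
      ∀ (V : Type) [Fintype V], Fintype.card V = 2 * n →
        ∀ m : V → V → ℕ, IsMultigraph m →
          (∀ u v, m u v ≤ r) →
          ∀ d : ℕ, (∀ v, mDeg m v = d) → (1 + ε) * r * n ≤ (d : ℝ) →
            OneFactorizable m := by
  classical
  have hR : (1 : ℝ) ≤ r := by exact_mod_cast hr
  obtain ⟨e, he0, he1, heε⟩ : ∃ e : ℝ, 0 < e ∧ e ≤ 1 ∧ e ≤ ε :=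
    ⟨min ε 1, by positivity, min_le_right _ _, min_le_left _ _⟩
  obtain ⟨ρ, hρ⟩ : ∃ ρ : ℝ, ρ = e ^ 2 / 1000 := ⟨_, rfl⟩
  obtain ⟨β, hβ⟩ : ∃ β : ℝ, β = e * ρ / (1000 * r) := ⟨_, rfl⟩
  obtain ⟨κ, hκ⟩ : ∃ κ : ℝ, κ = β * ρ / 100 := ⟨_, rfl⟩
  have hρ0 : 0 < ρ := by rw [hρ]; positivity
  have hβ0 : 0 < β := by rw [hβ]; positivity
  have hκ0 : 0 < κ := by rw [hκ]; positivity
  have hρ1 : ρ ≤ 1 := by rw [hρ]; nlinarith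
  have hβ1 : β ≤ 1 := by
    rw [hβ, div_le_one (by positivity)]
    nlinarith
  have hκ1 : κ ≤ 1 := by rw [hκ]; nlinarith
  obtain ⟨j, hj⟩ := pow_unbounded_of_one_lt (10 * r / κ) (one_lt_two : (1 : ℝ) < 2)
  obtain ⟨N₁, hN₁⟩ := exists_balanced_split r (κ / 5) (by positivity)
  obtain ⟨N₂, hN₂⟩ := exists_near_edge_coloring r j (κ / 5) (by positivity)
  refine ⟨max (max N₁ N₂) ⌈2 / β⌉₊, fun n hn V _ hV m hm hmr d hd hdε => ?_⟩
  obtain ⟨hsymm, hdiag⟩ := hm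
  have hn1 : N₁ ≤ n := (le_max_left _ _).trans ((le_max_left _ _).trans hn)
  have hn2 : N₂ ≤ n := (le_max_right _ _).trans ((le_max_left _ _).trans hn)
  have hn3 : 2 ≤ β * n := by
    have := (Nat.le_ceil (2 / β)).trans (Nat.cast_le.2 ((le_max_right _ _).trans hn))
    rwa [div_le_iff₀ hβ0, mul_comm] at this
  obtain ⟨s, hs, hdisc⟩ := hN₁ n hn1 V hV m hmr
  have hd' : ∀ v, ∑ u, m v u = d := hd
  have hsplit : ∀ v, (∑ u, insidePart s m v u : ℝ) + ∑ u, (crossPart s m v u : ℝ) = d := by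
    intro v
    rw [← hd' v]
    exact_mod_cast sum_insidePart_add_sum_crossPart s m v
  have hdiff : ∀ v, |(∑ u, insidePart s m v u : ℝ) - ∑ u, (crossPart s m v u : ℝ)| ≤ κ / 5 * n :=
    fun v => by
      rw [abs_sum_insidePart_sub_sum_crossPart]
      exact hdisc v
  have hn0 : (0 : ℝ) < n := by
    by_contra h
    nlinarith
  have hd2 : (d : ℝ) ≤ 2 * r * n := by
    have hV0 : 0 < Fintype.card V := by
      rw [hV]
      have : 0 < n := by exact_mod_cast hn0
      omega
    obtain ⟨v⟩ := Fintype.card_pos_iff.1 hV0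
    have : d ≤ 2 * n * r := by
      rw [← hd' v, ← hV, ← Finset.card_univ, ← smul_eq_mul, ← Finset.sum_const]
      exact Finset.sum_le_sum fun u _ => hmr v u
    have : (d : ℝ) ≤ 2 * n * r := by exact_mod_cast this
    linarith
  have hκn : κ * n ≤ r * n := by
    gcongr
    linarith
  set D : ℕ := ⌊((d : ℝ) + κ / 5 * n) / 2⌋₊ with hD
  have hD1 : (D : ℝ) ≤ (d + κ / 5 * n) / 2 := Nat.floor_le (by positivity)
  obtain ⟨L, hLi, hLm, hLc, hLd⟩ := hN₂ n hn2 V hV (insidePart s m) (insidePart_symm s hsymm)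
    (fun u v => (insidePart_le s m u v).trans (hmr u v)) D (fun v => by
      refine Nat.le_floor ?_
      have h1 := hsplit v
      have h2 := (abs_le.1 (hdiff v)).2
      push_cast
      linarith)
  have hDj : (D : ℝ) / 2 ^ j ≤ κ / 5 * n := by
    rw [div_lt_iff₀ hκ0] at hj
    rw [div_le_iff₀ (by positivity)]
    have h1 : (D : ℝ) ≤ 2 * r * n := by linarith
    nlinarith
  have hκn0 : 0 < κ * n := by positivity
  obtain ⟨T, hT, hTm⟩ := exists_perfect_decomposition_of_dense hs hV hsymm hdiag hr hmr hd' he0 he1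
    hρ hβ hκ hn3 (by
      refine le_trans ?_ hdε
      gcongr)
    (fun v => by
      have h1 := hsplit v
      have h2 := (abs_le.1 (hdiff v)).2
      linarith) L hLi hLm (by linarith)
    (fun v => by
      have h1 := hsplit v
      have h2 := (abs_le.1 (hdiff v)).1
      have h3 := hLd v
      linarith)
    (fun v => by
      have h3 := hLd v
      linarith)
  exact oneFactorizable_of_useCount_eq hT hTm
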